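/- arXiv:math/0605596 — 11 statements merged into one kernel-verified Lean document; each statement's English description precedes it below -/
import Mathlib

section
/- Let G be a locally compact second countable group with left Haar measure m_G, and let (G_t)_{t>0} be an admissible one-parameter family such that G_t = {g ∈ G : |g| ≤ t} for all t ≥ t₀, where |g| = inf{s > 0 : g ∈ G_s} is the associated gauge. Then the measure η on (t₀,∞) defined by η(J) = m_G({g ∈ G : |g| ∈ J}) for Borel sets J ⊆ (t₀,∞) is absolutely continuous with respect to Lebesgue measure on (t₀,∞). -/
open MeasureTheory Filter Set Pointwise

/-- Coarse admissibility of an increasing family of bounded Borel sets. -/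
structure CoarselyAdmissible {G : Type*} [Group G] [TopologicalSpace G]
    [MeasurableSpace G] (μ : Measure G) (B : ℝ → Set G) : Prop where
  mono : ∀ s t : ℝ, 0 < s → s ≤ t → B s ⊆ B t
  bounded : ∀ t : ℝ, 0 < t → IsCompact (closure (B t))
  borel : ∀ t : ℝ, 0 < t → MeasurableSet (B t)
  translate : ∀ Q : Set G, IsCompact Q →
    ∃ c > (0:ℝ), ∀ᶠ t in atTop, Q * B t * Q ⊆ B (t + c)
  volume_growth : ∀ c > (0:ℝ), ∃ d > (0:ℝ), ∀ᶠ t in atTop,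
    μ (B (t + c)) ≤ ENNReal.ofReal d * μ (B t)

/-- A family `O ε` (`0 < ε < 1`) of symmetric bounded neighborhoods of the identity,
decreasing as `ε` decreases. -/
structure NbhdBasisFamily {G : Type*} [Group G] [TopologicalSpace G]
    (O : ℝ → Set G) : Prop where
  mem_nhds : ∀ ε : ℝ, 0 < ε → ε < 1 → O ε ∈ nhds (1 : G)
  symm : ∀ ε : ℝ, 0 < ε → ε < 1 → (O ε)⁻¹ = O ε
  bounded : ∀ ε : ℝ, 0 < ε → ε < 1 → IsCompact (closure (O ε))
  mono : ∀ ε ε' : ℝ, 0 < ε → ε ≤ ε' → ε' < 1 → O ε ⊆ O ε'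

/-- A measure on `ℝ` whose values on half-open intervals are bounded by the increments of a
Stieltjes function is bounded by the corresponding Stieltjes measure. -/
theorem MeasureTheory.Measure.le_stieltjesFunction_measure (ν : Measure ℝ)
    (f : StieltjesFunction ℝ) (h : ∀ a b, ν (Ioc a b) ≤ ENNReal.ofReal (f b - f a)) :
    ν ≤ f.measure := by
  rw [StieltjesFunction.measure, ← Measure.toOuterMeasure_le]
  change ν.toOuterMeasure ≤ OuterMeasure.ofFunction f.length f.length_empty
  refine OuterMeasure.le_ofFunction.2 fun s => ?_
  change ν s ≤ f.length s
  rw [f.length_eq]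
  refine le_iInf₂ fun a b => le_iInf fun hs => ?_
  have hbot : (botSet : Set ℝ) = ∅ := by
    ext x
    simp [botSet]
  rw [hbot, sdiff_empty] at hs
  exact (measure_mono hs).trans (h a b)

theorem MeasureTheory.Measure.absolutelyContinuous_volume_of_Ioc_le (ν : Measure ℝ)
    (K : NNReal) (h : ∀ a b, ν (Ioc a b) ≤ K * ENNReal.ofReal (b - a)) : ν ≪ volume := by
  have hle : ν ≤ K • (volume : Measure ℝ) := by
    rw [Real.volume_eq_stieltjes_id, ← StieltjesFunction.measure_smul]
    refine ν.le_stieltjesFunction_measure _ fun a b => (h a b).trans_eq ?_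
    change _ = ENNReal.ofReal (K * b - K * a)
    rw [← mul_sub, ENNReal.ofReal_mul K.coe_nonneg, ENNReal.ofReal_coe_nnreal]
  exact (Measure.absolutelyContinuous_of_le hle).trans
    (Measure.smul_absolutelyContinuous (c := (K : ENNReal)))

/-- **Absolute continuity of the gauge measure** (Gorodnik–Nevo, Proposition 3.10).
Let `(B t)` be an admissible one-parameter family (coarsely admissible, with the Lipschitz
stability and volume-continuity conditions holding with constants `c, t₀, ε₀`), such that
`B t = {g : |g| ≤ t}` for `t ≥ t₀`, where `|g| = inf {s > 0 : g ∈ B s}` is the gauge. Then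
the pushforward of Haar measure under the gauge is absolutely continuous with respect to
Lebesgue measure on `(t₀, ∞)`. -/
theorem gauge_pushforward_absolutelyContinuous
    {G : Type*} [Group G] [TopologicalSpace G] [IsTopologicalGroup G]
    [LocallyCompactSpace G] [SecondCountableTopology G]
    [MeasurableSpace G] [BorelSpace G]
    (μ : Measure G) [μ.IsHaarMeasure]
    (O : ℝ → Set G) (hO : NbhdBasisFamily O)
    (B : ℝ → Set G) (hCA : CoarselyAdmissible μ B)
    (c t₀ ε₀ : ℝ) (hc : 0 < c) (ht₀ : 0 < t₀) (hε₀ : 0 < ε₀)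
    (hstab : ∀ t ≥ t₀, ∀ ε : ℝ, 0 < ε → ε ≤ ε₀ → O ε * B t * O ε ⊆ B (t + c * ε))
    (hlip : ∀ t ≥ t₀, ∀ ε : ℝ, 0 < ε → ε ≤ ε₀ →
      μ (B (t + ε)) ≤ ENNReal.ofReal (1 + c * ε) * μ (B t))
    (gauge : G → ℝ) (hgauge : ∀ g : G, gauge g = sInf {s : ℝ | 0 < s ∧ g ∈ B s})
    (hBg : ∀ t ≥ t₀, B t = {g : G | gauge g ≤ t}) :
    ∀ J : Set ℝ, J ⊆ Ioi t₀ → MeasurableSet J → volume J = 0 → μ (gauge ⁻¹' J) = 0 := by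
  intro J hJ hJm hJ0
  set f : G → ℝ := fun g => max (gauge g) t₀ with hf
  have hfB : ∀ t ≥ t₀, f ⁻¹' Iic t = B t := fun t ht => by
    ext g
    simp [hBg t ht, hf, ht.le]
  have hfm : Measurable f := by
    refine measurable_of_Iic fun t => ?_
    rcases le_or_gt t₀ t with ht | ht
    · rw [hfB t ht]
      exact hCA.borel t (ht₀.trans_le ht)
    · convert MeasurableSet.empty
      ext g
      simp [hf, ht]
  have hfin : ∀ t, 0 < t → μ (B t) ≠ ⊤ := fun t ht =>
    ((measure_mono subset_closure).trans_lt (hCA.bounded t ht).measure_lt_top).ne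
  have hfJ : gauge ⁻¹' J ⊆ f ⁻¹' J := fun g hg => by
    have : t₀ < gauge g := hJ hg
    simpa [hf, max_eq_left this.le] using hg
  have hIoc : ∀ p q, t₀ ≤ p → q ≤ p + ε₀ →
      μ.map f (Ioc p q) ≤ ENNReal.ofReal c * μ (B q) * ENNReal.ofReal (q - p) := by
    intro p q hp hq
    rcases le_or_gt q p with hqp | hpq
    · simp [Ioc_eq_empty hqp.not_gt]
    have hsub : B p ⊆ B q := hCA.mono p q (ht₀.trans_le hp) hpq.le
    have hpre : f ⁻¹' Ioc p q = B q \ B p := by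
      rw [← hfB p hp, ← hfB q (hp.trans hpq.le), ← preimage_sdiff, Iic_sdiff_Iic]
    have h := hlip p hp (q - p) (by linarith) (by linarith)
    rw [add_sub_cancel, ENNReal.ofReal_add zero_le_one (by nlinarith), ENNReal.ofReal_one,
      add_mul, one_mul, ENNReal.ofReal_mul hc.le] at h
    rw [Measure.map_apply hfm measurableSet_Ioc, hpre,
      measure_sdiff hsub (hCA.borel p (ht₀.trans_le hp)).nullMeasurableSet
        (hfin p (ht₀.trans_le hp))]
    calc μ (B q) - μ (B p)
        ≤ ENNReal.ofReal c * ENNReal.ofReal (q - p) * μ (B p) := tsub_le_iff_left.2 h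
      _ ≤ ENNReal.ofReal c * ENNReal.ofReal (q - p) * μ (B q) := by gcongr
      _ = _ := by ring
  have hnull : ∀ n : ℕ, μ.map f (J ∩ Ioc (t₀ + n * ε₀) (t₀ + n * ε₀ + ε₀)) = 0 := by
    intro n
    set a := t₀ + n * ε₀
    have ha : t₀ ≤ a := le_add_of_nonneg_right (by positivity)
    have hac : (μ.map f).restrict (Ioc a (a + ε₀)) ≪ volume := by
      refine Measure.absolutelyContinuous_volume_of_Ioc_le _
        (ENNReal.ofReal c * μ (B (a + ε₀))).toNNReal fun x y => ?_
      rw [ENNReal.coe_toNNReal (ENNReal.mul_ne_top ENNReal.ofReal_ne_top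
        (hfin _ (by linarith))), Measure.restrict_apply measurableSet_Ioc, Ioc_inter_Ioc]
      rcases le_or_gt (min y (a + ε₀)) (max x a) with hle | hlt
      · simp [Ioc_eq_empty hle.not_gt]
      refine (hIoc _ _ (ha.trans (le_max_right _ _))
        ((min_le_right _ _).trans (by gcongr; exact le_max_right _ _))).trans ?_
      have hB : B (min y (a + ε₀)) ⊆ B (a + ε₀) :=
        hCA.mono _ _ (ht₀.trans_le (ha.trans ((le_max_right _ _).trans hlt.le))) (min_le_right _ _)
      gcongr
      · exact min_le_left _ _
      · exact le_max_left _ _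
    simpa [Measure.restrict_apply hJm] using hac hJ0
  refine measure_mono_null hfJ ?_
  rw [← Measure.map_apply hfm hJm]
  refine measure_mono_null (fun x hx => ?_) (measure_iUnion_null hnull)
  have hpos : 0 < x - t₀ := sub_pos.2 (hJ hx)
  obtain ⟨n, hn⟩ := Nat.exists_eq_succ_of_ne_zero (Nat.ceil_pos.2 (div_pos hpos hε₀)).ne'
  obtain ⟨h₁, h₂⟩ := (Nat.ceil_eq_iff n.succ_ne_zero).1 hn
  rw [Nat.succ_sub_one, lt_div_iff₀ hε₀] at h₁
  rw [div_le_iff₀ hε₀, Nat.cast_succ] at h₂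
  exact mem_iUnion.2 ⟨n, hx, by linarith, by linarith⟩
end

section
/- Invariance principle: let G be a locally compact second countable group with left Haar measure m_G, acting measurably on a standard Borel probability space (X, B, ν) and preserving ν. Let (G_t)_{t>0} be a quasi-uniform increasing family of bounded Borel subsets of G, and suppose the averages β_t satisfy the pointwise ergodic theorem in L^p(ν) for some p ≥ 1. Then for every f ∈ L^p(ν) there exists a set Ω(f) ⊆ X, measurable with respect to the ν-completion of B, with ν(Ω(f)) = 1 and g·Ω(f) = Ω(f) for every g ∈ G, such that lim_{t→∞} π(β_t)f(x) = ∫_X f dν for every x ∈ Ω(f). -/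
open MeasureTheory Filter Set Pointwise
open scoped ENNReal NNReal

/-- A quasi-uniform increasing family of bounded Borel subsets of a group `G` with left
Haar measure `μ`: (i) for every `ε > 0` there is a neighborhood `O` of the identity with
`O · B t ⊆ B (t + ε)` for all large `t`; (ii) for every `δ > 0` there is `ε > 0` with
`μ (B (t + ε)) ≤ (1 + δ) μ (B t)` for all large `t`. -/
structure QuasiUniform {G : Type*} [Group G] [TopologicalSpace G]
    [MeasurableSpace G] (μ : Measure G) (B : ℝ → Set G) : Prop where
  mono : ∀ s t : ℝ, 0 < s → s ≤ t → B s ⊆ B t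
  bounded : ∀ t : ℝ, 0 < t → IsCompact (closure (B t))
  borel : ∀ t : ℝ, 0 < t → MeasurableSet (B t)
  local_stability : ∀ ε > (0:ℝ), ∃ O ∈ nhds (1 : G), ∀ᶠ t in atTop, O * B t ⊆ B (t + ε)
  continuity : ∀ δ > (0:ℝ), ∃ ε > (0:ℝ), ∀ᶠ t in atTop,
    μ (B (t + ε)) ≤ ENNReal.ofReal (1 + δ) * μ (B t)

/-- The averaging operator `π(β_t) f (x) = (1 / μ (B t)) ∫_{B t} f (g⁻¹ • x) dμ(g)`
associated to the Haar-uniform probability measures `β_t` on the sets `B t`. -/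
noncomputable def ergAvg {G X : Type*} [Group G] [MeasurableSpace G] [MulAction G X]
    (μ : Measure G) (B : ℝ → Set G) (f : X → ℝ) (t : ℝ) (x : X) : ℝ :=
  (μ (B t)).toReal⁻¹ * ∫ g in B t, f (g⁻¹ • x) ∂μ

section InvariancePrinciple

variable {G X : Type*} [Group G] [MeasurableSpace G] [MulAction G X]
  {μ : Measure G} {B : ℝ → Set G} {F : X → ℝ}

/-- Translating the base point by `u` amounts to translating the domain by `u⁻¹`. -/
theorem integrableOn_smul_and_setIntegral_le [MeasurableMul G] [μ.IsMulLeftInvariant]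
    (hF : ∀ x, 0 ≤ F x) {S T : Set G} {u : G}
    (hST : ∀ h ∈ S, u⁻¹ * h ∈ T) {y : X}
    (hint : IntegrableOn (fun h => F (h⁻¹ • y)) T μ) :
    IntegrableOn (fun h => F (h⁻¹ • u • y)) S μ ∧
      ∫ h in S, F (h⁻¹ • u • y) ∂μ ≤ ∫ h in T, F (h⁻¹ • y) ∂μ := by
  have hmp : MeasurePreserving (MeasurableEquiv.mulLeft u⁻¹) μ μ :=
    measurePreserving_mul_left μ u⁻¹
  have hemb := (MeasurableEquiv.mulLeft (u⁻¹ : G)).measurableEmbedding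
  have hcomp : (fun h : G => F (h⁻¹ • u • y)) =
      (fun h => F (h⁻¹ • y)) ∘ MeasurableEquiv.mulLeft u⁻¹ := by
    funext h
    simp [mul_smul]
  have hsub : S ⊆ MeasurableEquiv.mulLeft u⁻¹ ⁻¹' T := fun h hh => hST h hh
  have hpre : IntegrableOn (fun h => F (h⁻¹ • u • y)) (MeasurableEquiv.mulLeft u⁻¹ ⁻¹' T) μ := by
    rw [hcomp]
    exact (hmp.integrableOn_comp_preimage hemb).2 hint
  refine ⟨hpre.mono_set hsub, ?_⟩
  have heq : ∫ h in MeasurableEquiv.mulLeft u⁻¹ ⁻¹' T, F (h⁻¹ • u • y) ∂μ =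
      ∫ h in T, F (h⁻¹ • y) ∂μ := by
    rw [hcomp]
    exact hmp.setIntegral_preimage_emb hemb (fun h => F (h⁻¹ • y)) T
  rw [← heq]
  exact setIntegral_mono_set hpre (Eventually.of_forall fun h => hF _) hsub.eventuallyLE

/-- The averages can only converge to a nonzero limit if they are eventually averages of
integrable functions. -/
theorem eventually_integrableOn_of_tendsto_ergAvg {L : ℝ} (hL : L ≠ 0) {y : X}
    (h : Tendsto (fun t => ergAvg μ B F t y) atTop (nhds L)) :
    ∀ᶠ t in atTop, IntegrableOn (fun g => F (g⁻¹ • y)) (B t) μ := by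
  filter_upwards [h.eventually_ne hL] with t ht
  by_contra hint
  exact ht (by rw [ergAvg, integral_undef hint, mul_zero])

variable [TopologicalSpace G]

namespace QuasiUniform

theorem measure_ne_top [IsFiniteMeasureOnCompacts μ] (hB : QuasiUniform μ B) {t : ℝ}
    (ht : 0 < t) : μ (B t) ≠ ∞ :=
  ne_top_of_le_ne_top (hB.bounded t ht).measure_lt_top.ne (measure_mono subset_closure)

/-- Moving the base point by a small group element changes the averages of a nonnegative
function by a factor close to `1`, up to a small change of the parameter. -/
theorem exists_ergAvg_smul_le [IsFiniteMeasureOnCompacts μ] [MeasurableMul G]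
    [μ.IsMulLeftInvariant] (hB : QuasiUniform μ B) (hF : ∀ x, 0 ≤ F x) {δ : ℝ} (hδ : 0 < δ) :
    ∃ ε : ℝ, ∃ O ∈ nhds (1 : G), ∀ᶠ t in atTop, ∀ u : G, u⁻¹ ∈ O → ∀ y : X,
      IntegrableOn (fun h => F (h⁻¹ • y)) (B (t + ε)) μ →
      IntegrableOn (fun h => F (h⁻¹ • u • y)) (B t) μ ∧
        ergAvg μ B F t (u • y) ≤ (1 + δ) * ergAvg μ B F (t + ε) y := by
  obtain ⟨ε, hε, hcont⟩ := hB.continuity δ hδ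
  obtain ⟨O, hO, hstab⟩ := hB.local_stability ε hε
  refine ⟨ε, O, hO, ?_⟩
  filter_upwards [hcont, hstab, eventually_gt_atTop 0] with t hc hs ht u hu y hint
  have hte : 0 < t + ε := by positivity
  obtain ⟨hint', hle⟩ := integrableOn_smul_and_setIntegral_le hF
    (fun h hh => hs (mul_mem_mul hu hh)) hint
  refine ⟨hint', ?_⟩
  unfold ergAvg
  have hI : 0 ≤ ∫ h in B (t + ε), F (h⁻¹ • y) ∂μ := integral_nonneg fun h => hF _
  have hfin := hB.measure_ne_top ht
  have hfin' := hB.measure_ne_top hte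
  have hreal : (μ (B (t + ε))).toReal ≤ (1 + δ) * (μ (B t)).toReal := by
    have h := ENNReal.toReal_mono (ENNReal.mul_ne_top ENNReal.ofReal_ne_top hfin) hc
    rwa [ENNReal.toReal_mul, ENNReal.toReal_ofReal (by positivity)] at h
  have hmono : (μ (B t)).toReal ≤ (μ (B (t + ε))).toReal :=
    ENNReal.toReal_mono hfin' (measure_mono (hB.mono t _ ht (by linarith)))
  have hinv : (μ (B t)).toReal⁻¹ ≤ (1 + δ) * (μ (B (t + ε))).toReal⁻¹ := by
    rcases (ENNReal.toReal_nonneg (a := μ (B t))).eq_or_lt with h0 | h0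
    · rw [← h0, inv_zero]
      positivity
    · rw [← div_eq_mul_inv, le_div_iff₀ (h0.trans_le hmono), inv_mul_le_iff₀ h0]
      linarith
  calc (μ (B t)).toReal⁻¹ * ∫ h in B t, F (h⁻¹ • u • y) ∂μ
      ≤ (μ (B t)).toReal⁻¹ * ∫ h in B (t + ε), F (h⁻¹ • y) ∂μ := by gcongr
    _ ≤ (1 + δ) * (μ (B (t + ε))).toReal⁻¹ * ∫ h in B (t + ε), F (h⁻¹ • y) ∂μ := by gcongr
    _ = _ := mul_assoc _ _ _

end QuasiUniform

/-- For a nonnegative function, convergence of the averages to a positive limit along a dense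
part of an orbit implies convergence along the whole orbit. -/
theorem QuasiUniform.tendsto_ergAvg_smul_of_dense [IsTopologicalGroup G]
    [IsFiniteMeasureOnCompacts μ] [MeasurableMul G] [μ.IsMulLeftInvariant]
    (hB : QuasiUniform μ B) (hF : ∀ x, 0 ≤ F x) {D : Set G} (hD : Dense D) {L : ℝ} (hL : 0 < L)
    {x : X} (hx : ∀ d ∈ D, Tendsto (fun t => ergAvg μ B F t (d • x)) atTop (nhds L)) (g : G) :
    Tendsto (fun t => ergAvg μ B F t (g • x)) atTop (nhds L) := by
  have key : ∀ δ > 0, ∃ ε : ℝ, ∃ d ∈ D,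
      (∀ᶠ t in atTop, ergAvg μ B F t (g • x) ≤ (1 + δ) * ergAvg μ B F (t + ε) (d • x)) ∧
      (∀ᶠ t in atTop, ergAvg μ B F t (d • x) ≤ (1 + δ) * ergAvg μ B F (t + ε) (g • x)) := by
    intro δ hδ
    obtain ⟨ε, O, hO, hev⟩ := hB.exists_ergAvg_smul_le hF hδ
    have hnhds : {d : G | d * g⁻¹ ∈ O ∧ g * d⁻¹ ∈ O} ∈ nhds g := by
      have h1 : Tendsto (fun d : G => d * g⁻¹) (nhds g) (nhds 1) := by
        simpa using (continuous_mul_const g⁻¹).tendsto g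
      have h2 : Tendsto (fun d : G => g * d⁻¹) (nhds g) (nhds 1) := by
        simpa [Function.comp_def] using ((continuous_const_mul g).comp continuous_inv).tendsto g
      exact inter_mem (h1 hO) (h2 hO)
    obtain ⟨d, ⟨hd1, hd2⟩, hdD⟩ := mem_closure_iff_nhds.1 (hD g) _ hnhds
    have hshift : Tendsto (fun t : ℝ => t + ε) atTop atTop :=
      tendsto_atTop_add_const_right _ _ tendsto_id
    have hint := hshift.eventually (eventually_integrableOn_of_tendsto_ergAvg hL.ne' (hx d hdD))
    have hg : ∀ᶠ t in atTop, IntegrableOn (fun h => F (h⁻¹ • g • x)) (B t) μ ∧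
        ergAvg μ B F t (g • x) ≤ (1 + δ) * ergAvg μ B F (t + ε) (d • x) := by
      filter_upwards [hev, hint] with t ht hti
      simpa [smul_smul] using ht (g * d⁻¹) (by simpa using hd1) (d • x) hti
    refine ⟨ε, d, hdD, hg.mono fun t ht => ht.2, ?_⟩
    filter_upwards [hev, hshift.eventually hg] with t ht hti
    simpa [smul_smul] using (ht (d * g⁻¹) (by simpa using hd2) (g • x) hti.1).2
  have hδ : ∀ a b : ℝ, a < b → ∃ δ > 0, (1 + δ) * a < b := by
    intro a b hab
    have hc : Tendsto (fun δ : ℝ => (1 + δ) * a) (nhdsWithin 0 (Ioi 0)) (nhds a) := by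
      have : ContinuousAt (fun δ : ℝ => (1 + δ) * a) 0 := by fun_prop
      simpa [ContinuousAt] using this.tendsto.mono_left nhdsWithin_le_nhds
    obtain ⟨δ, h1, h2⟩ := ((hc.eventually_lt_const hab).and self_mem_nhdsWithin).exists
    exact ⟨δ, h2, h1⟩
  refine tendsto_order.2 ⟨fun a ha => ?_, fun b hb => ?_⟩
  · obtain ⟨δ, hδ0, hδa⟩ := hδ a L ha
    obtain ⟨ε, d, hdD, -, hlow⟩ := key δ hδ0
    have hshift : Tendsto (fun t : ℝ => t - ε) atTop atTop :=
      tendsto_atTop_add_const_right _ (-ε) tendsto_id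
    filter_upwards [hshift.eventually ((hx d hdD).eventually_const_lt hδa),
      hshift.eventually hlow] with t h1 h2
    rw [sub_add_cancel] at h2
    exact lt_of_mul_lt_mul_left (h1.trans_le h2) (by positivity)
  · obtain ⟨δ, hδ0, hδb⟩ := hδ L b hb
    obtain ⟨ε, d, hdD, hup, -⟩ := key δ hδ0
    have hshift : Tendsto (fun t : ℝ => t + ε) atTop atTop :=
      tendsto_atTop_add_const_right _ _ tendsto_id
    filter_upwards [hup, (((hx d hdD).const_mul (1 + δ)).comp hshift).eventually_lt_const hδb]
      with t h1 h2
    exact h1.trans_lt h2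

/-- Almost every orbit is an orbit of convergence for the averages of a nonnegative function
with positive integral. -/
theorem QuasiUniform.ae_forall_tendsto_ergAvg_smul [IsTopologicalGroup G]
    [TopologicalSpace.SeparableSpace G] [IsFiniteMeasureOnCompacts μ] [MeasurableMul G]
    [μ.IsMulLeftInvariant] [MeasurableSpace X] [MeasurableConstSMul G X] {ν : Measure X}
    [SMulInvariantMeasure G X ν] (hB : QuasiUniform μ B) (hF : ∀ x, 0 ≤ F x) {L : ℝ} (hL : 0 < L)
    (h : ∀ᵐ x ∂ν, Tendsto (fun t => ergAvg μ B F t x) atTop (nhds L)) :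
    ∀ᵐ x ∂ν, ∀ g : G, Tendsto (fun t => ergAvg μ B F t (g • x)) atTop (nhds L) := by
  obtain ⟨D, hDc, hD⟩ := TopologicalSpace.exists_countable_dense G
  have hae : ∀ᵐ x ∂ν, ∀ d ∈ D, Tendsto (fun t => ergAvg μ B F t (d • x)) atTop (nhds L) :=
    (ae_ball_iff hDc).2 fun d _ => (measurePreserving_smul d ν).quasiMeasurePreserving.ae h
  exact hae.mono fun x hx g => hB.tendsto_ergAvg_smul_of_dense hF hD hL hx g

end InvariancePrinciple

/-- **The invariance principle** (Gorodnik–Nevo, Theorem 5.19). Let `G` be an lcsc group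
with left Haar measure `μ` acting measurably on a standard Borel probability space `(X, ν)`
preserving `ν`. If `(B t)` is a quasi-uniform family and the averages `β_t` satisfy the
pointwise ergodic theorem in `L^p(ν)`, then for every `f ∈ L^p(ν)` the set of points where
`π(β_t) f (x) → ∫ f dν` contains a strictly `G`-invariant `ν`-conull set, measurable with
respect to the `ν`-completion. -/
theorem invariance_principle
    {G : Type*} [Group G] [TopologicalSpace G] [IsTopologicalGroup G]
    [LocallyCompactSpace G] [SecondCountableTopology G]
    [MeasurableSpace G] [BorelSpace G]
    (μ : Measure G) [μ.IsHaarMeasure]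
    {X : Type*} [MeasurableSpace X] [StandardBorelSpace X]
    [MulAction G X] [MeasurableSMul G X]
    (ν : Measure X) [IsProbabilityMeasure ν] [SMulInvariantMeasure G X ν]
    (B : ℝ → Set G) (hB : QuasiUniform μ B)
    (p : ℝ≥0∞) (hp : 1 ≤ p)
    (hpointwise : ∀ f : X → ℝ, MemLp f p ν →
      ∀ᵐ x ∂ν, Tendsto (fun t => ergAvg μ B f t x) atTop (nhds (∫ y, f y ∂ν))) :
    ∀ f : X → ℝ, MemLp f p ν →
      ∃ Ω : Set X, NullMeasurableSet Ω ν ∧ ν Ω = 1 ∧ (∀ g : G, g • Ω = Ω) ∧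
        ∀ x ∈ Ω, Tendsto (fun t => ergAvg μ B f t x) atTop (nhds (∫ y, f y ∂ν)) := by
  intro f hf
  have hone : MemLp (fun _ : X => (1 : ℝ)) p ν := memLp_const 1
  have hpos : MemLp (fun x => max (f x) 0 + 1) p ν := hf.pos_part.add hone
  have hneg : MemLp (fun x => max (-f x) 0 + 1) p ν := hf.neg_part.add hone
  have hintegral_pos : ∀ F : X → ℝ, MemLp F p ν → (∀ x, 1 ≤ F x) → 0 < ∫ x, F x ∂ν := by
    intro F hF h1
    have h := integral_mono (integrable_const (1 : ℝ)) (hF.integrable hp) h1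
    rw [integral_const, probReal_univ, one_smul] at h
    linarith
  have hge₁ : ∀ x, 1 ≤ max (f x) 0 + 1 := fun x => by simp
  have hge₂ : ∀ x, 1 ≤ max (-f x) 0 + 1 := fun x => by simp
  have hL₁ := hintegral_pos _ hpos hge₁
  have hL₂ := hintegral_pos _ hneg hge₂
  have hae₁ := hB.ae_forall_tendsto_ergAvg_smul (fun x => zero_le_one.trans (hge₁ x)) hL₁
    (hpointwise _ hpos)
  have hae₂ := hB.ae_forall_tendsto_ergAvg_smul (fun x => zero_le_one.trans (hge₂ x)) hL₂
    (hpointwise _ hneg)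
  have hdecomp : ∀ y, f y = (max (f y) 0 + 1) - (max (-f y) 0 + 1) := fun y => by
    rcases le_total (f y) 0 with h | h <;> simp [h]
  have hae : ∀ᵐ x ∂ν, ∀ g : G,
      Tendsto (fun t => ergAvg μ B f t (g • x)) atTop (nhds (∫ y, f y ∂ν)) := by
    filter_upwards [hae₁, hae₂] with x hx₁ hx₂ g
    have hlim := (hx₁ g).sub (hx₂ g)
    rw [← integral_sub (hpos.integrable hp) (hneg.integrable hp)] at hlim
    simp only [← hdecomp] at hlim
    refine hlim.congr' ?_
    filter_upwards [eventually_integrableOn_of_tendsto_ergAvg hL₁.ne' (hx₁ g),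
      eventually_integrableOn_of_tendsto_ergAvg hL₂.ne' (hx₂ g)] with t h₁ h₂
    simp only [ergAvg]
    rw [← mul_sub, ← integral_sub h₁ h₂]
    simp only [← hdecomp]
  refine ⟨{x | ∀ g : G, Tendsto (fun t => ergAvg μ B f t (g • x)) atTop (nhds (∫ y, f y ∂ν))},
    ?_, ?_, fun g => ?_, fun x hx => by simpa using hx 1⟩
  · exact nullMeasurableSet_univ.congr (eventuallyEq_univ.2 hae).symm
  · rw [measure_congr (eventuallyEq_univ.2 hae), measure_univ]
  · ext x
    rw [mem_smul_set_iff_inv_smul_mem]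
    refine ⟨fun hx k => ?_, fun hx k => ?_⟩
    · simpa [smul_smul] using hx (k * g)
    · simpa [smul_smul] using hx (k * g⁻¹)
end

section
/- Let G be a locally compact second countable group with left Haar measure m_G, acting measurably on a standard Borel probability space (X, B, ν) and preserving ν. Let (G_t)_{t>0} be a quasi-uniform increasing family of bounded Borel subsets of G, and suppose the averages β_t satisfy the pointwise ergodic theorem in L^p(ν) for some p ≥ 1. Then for every g, h ∈ G the Haar-uniform averages on g·G_t·h also satisfy the pointwise ergodic theorem in L^p(ν): for every f ∈ L^p(ν), (1/m_G(g·G_t·h)) ∫_{g·G_t·h} f(u⁻¹·x) dm_G(u) → ∫_X f dν as t → ∞, for ν-almost every x ∈ X. -/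
open MeasureTheory Filter Set Pointwise
open scoped ENNReal NNReal

/-- Under `b ↦ g * b * h` a Haar measure is multiplied by the modular character of `h`. -/
lemma map_mul_mul_eq_modularCharacterFun_smul
    {G : Type*} [Group G] [TopologicalSpace G] [IsTopologicalGroup G]
    [LocallyCompactSpace G] [SecondCountableTopology G]
    [MeasurableSpace G] [BorelSpace G] (μ : Measure G) [μ.IsHaarMeasure] (g h : G) :
    Measure.map (fun b => g * b * h) μ = Measure.modularCharacterFun h • μ := by
  have h1 : Measure.map (fun b => g * b * h) μ
      = Measure.map (· * h) (Measure.map (g * ·) μ) :=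
    (Measure.map_map (measurable_mul_const h) (measurable_const_mul g)).symm
  rw [h1, map_mul_left_eq_self, Measure.modularCharacterFun_eq_haarScalarFactor μ]
  exact Measure.isMulLeftInvariant_eq_smul _ μ

/-- The average over `g · B t · h` is the average over `B t` of the function translated by `h`,
evaluated at `g⁻¹ • x`: the modular factor cancels in the normalization. -/
lemma ergAvg_translate
    {G X : Type*} [Group G] [TopologicalSpace G] [IsTopologicalGroup G]
    [LocallyCompactSpace G] [SecondCountableTopology G]
    [MeasurableSpace G] [BorelSpace G] [MulAction G X]
    (μ : Measure G) [μ.IsHaarMeasure] (B : ℝ → Set G) (g h : G) (f : X → ℝ) (t : ℝ) (x : X) :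
    ergAvg μ (fun s => {g} * B s * {h}) f t x
      = ergAvg μ B (fun y => f (h⁻¹ • y)) t (g⁻¹ • x) := by
  let φ : G ≃ᵐ G := (MeasurableEquiv.mulLeft g).trans (MeasurableEquiv.mulRight h)
  have hpre : φ ⁻¹' ({g} * B t * {h}) = B t := by
    ext b
    simp [φ, Set.singleton_mul, Set.mul_singleton]
  set c := Measure.modularCharacterFun h
  have hc : (c : ℝ) ≠ 0 := by exact_mod_cast (Measure.modularCharacterFun_pos h).ne'
  have hmap : Measure.map φ μ = c • μ := map_mul_mul_eq_modularCharacterFun_smul μ g h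
  have hmeas : (μ (B t)).toReal = c * (μ ({g} * B t * {h})).toReal := by
    rw [← hpre, ← φ.map_apply, hmap, hpre]
    simp
  have hint : ∫ b in B t, f (h⁻¹ • b⁻¹ • g⁻¹ • x) ∂μ
      = c * ∫ u in {g} * B t * {h}, f (u⁻¹ • x) ∂μ := by
    have key := φ.measurableEmbedding.setIntegral_map (μ := μ) (fun u => f (u⁻¹ • x))
      ({g} * B t * {h})
    rw [hpre, hmap, Measure.restrict_smul, integral_smul_nnreal_measure] at key
    simpa [φ, mul_smul, NNReal.smul_def] using key.symm
  unfold ergAvg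
  rw [hint, hmeas, mul_inv, mul_mul_mul_comm, inv_mul_cancel₀ hc, one_mul]

/-- **Pointwise ergodic theorem for translated families** (Gorodnik–Nevo, Corollary 5.20).
If the Haar-uniform averages on a quasi-uniform family `(B t)` satisfy the pointwise
ergodic theorem in `L^p(ν)` in a measure-preserving action of `G` on a standard Borel
probability space `(X, ν)`, then for any fixed `g, h ∈ G` the Haar-uniform averages on the
translated sets `g · B t · h` also satisfy the pointwise ergodic theorem in `L^p(ν)`. -/
theorem pointwise_ergodic_for_translates
    {G : Type*} [Group G] [TopologicalSpace G] [IsTopologicalGroup G]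
    [LocallyCompactSpace G] [SecondCountableTopology G]
    [MeasurableSpace G] [BorelSpace G]
    (μ : Measure G) [μ.IsHaarMeasure]
    {X : Type*} [MeasurableSpace X] [StandardBorelSpace X]
    [MulAction G X] [MeasurableSMul G X]
    (ν : Measure X) [IsProbabilityMeasure ν] [SMulInvariantMeasure G X ν]
    (B : ℝ → Set G) (hB : QuasiUniform μ B)
    (p : ℝ≥0∞) (hp : 1 ≤ p)
    (hpointwise : ∀ f : X → ℝ, MemLp f p ν →
      ∀ᵐ x ∂ν, Tendsto (fun t => ergAvg μ B f t x) atTop (nhds (∫ y, f y ∂ν))) :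
    ∀ g h : G, ∀ f : X → ℝ, MemLp f p ν →
      ∀ᵐ x ∂ν, Tendsto (fun t => ergAvg μ (fun s => {g} * B s * {h}) f t x)
        atTop (nhds (∫ y, f y ∂ν)) := by
  intro g h f hf
  have hmp (a : G) : MeasurePreserving (a • · : X → X) ν ν := measurePreserving_smul a ν
  have hconv := hpointwise _ (hf.comp_measurePreserving (hmp h⁻¹))
  have hint : ∫ y, (f ∘ (h⁻¹ • ·)) y ∂ν = ∫ y, f y ∂ν :=
    (hmp h⁻¹).integral_comp (measurableEmbedding_const_smul h⁻¹) f
  rw [hint] at hconv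
  filter_upwards [(hmp g⁻¹).quasiMeasurePreserving.ae hconv] with x hx
  simp only [ergAvg_translate]
  exact hx
end

section
/- Let G be a locally compact second countable group with left Haar measure m_G, let Γ ≤ G be a discrete subgroup, and let (G_t)_{t>0} be a coarsely admissible increasing family of bounded Borel subsets of G. Then the sets Γ ∩ G_t are finite and there exists C > 0 such that |Γ ∩ G_t| ≤ C·m_G(G_t) for all sufficiently large t. -/
open MeasureTheory Filter Set Pointwise
open scoped ENNReal NNReal

/-- For a discrete subgroup `Γ`, some open neighbourhood of the identity meets each right coset
of `Γ` in at most one point. -/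
theorem exists_open_div_mem_eq_one
    {G : Type*} [Group G] [TopologicalSpace G] [IsTopologicalGroup G]
    (Γ : Subgroup G) [DiscreteTopology Γ] :
    ∃ W : Set G, IsOpen W ∧ (1 : G) ∈ W ∧ ∀ v ∈ W, ∀ w ∈ W, v / w ∈ Γ → v = w := by
  obtain ⟨V, hV, hV1⟩ := isOpen_induced_iff.mp (isOpen_discrete ({1} : Set Γ))
  have h1V : (1 : G) ∈ V := by
    have h : (1 : Γ) ∈ Subtype.val ⁻¹' V := hV1 ▸ mem_singleton _
    exact h
  obtain ⟨U, hU, hUV⟩ := exists_nhds_split_inv (hV.mem_nhds h1V)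
  obtain ⟨W, hWU, hW, h1W⟩ := mem_nhds_iff.mp hU
  refine ⟨W, hW, h1W, fun v hv w hw hΓ => ?_⟩
  have h : (⟨v / w, hΓ⟩ : Γ) ∈ Subtype.val ⁻¹' V := hUV v (hWU hv) w (hWU hw)
  rw [hV1] at h
  exact div_eq_one.mp (congrArg Subtype.val h)

/-- A discrete subgroup meets every relatively compact set in a finite set. -/
theorem finite_subgroup_inter_of_isCompact_closure
    {G : Type*} [Group G] [TopologicalSpace G] [IsTopologicalGroup G]
    (Γ : Subgroup G) [DiscreteTopology Γ] {A : Set G} (hA : IsCompact (closure A)) :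
    ((Γ : Set G) ∩ A).Finite := by
  obtain ⟨W, hW, h1W, hWΓ⟩ := exists_open_div_mem_eq_one Γ
  obtain ⟨T, -, hT⟩ := hA.elim_nhds_subcover (fun x => (fun y => y * x⁻¹) ⁻¹' W) fun x _ =>
    (hW.preimage (continuous_mul_const x⁻¹)).mem_nhds (by simpa using h1W)
  have hfin : (⋃ x ∈ T, (Γ : Set G) ∩ (fun y => y * x⁻¹) ⁻¹' W).Finite := by
    refine T.finite_toSet.biUnion fun x _ => Set.Subsingleton.finite ?_
    rintro a ⟨ha, haW⟩ b ⟨hb, hbW⟩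
    refine mul_right_cancel (hWΓ _ haW _ hbW ?_)
    simpa [div_eq_mul_inv] using Γ.mul_mem ha (Γ.inv_mem hb)
  refine hfin.subset ?_
  rintro a ⟨ha, haA⟩
  obtain ⟨x, hx, hax⟩ := mem_iUnion₂.mp (hT (subset_closure haA))
  exact mem_iUnion₂.mpr ⟨x, hx, ha, hax⟩

/-- **Upper bound for lattice points in coarsely admissible sets**
(Gorodnik–Nevo, Lemma 6.9(1)). If `Γ` is a discrete subgroup of an lcsc group `G` with
left Haar measure `μ` and `(B t)` is coarsely admissible, then each `Γ ∩ B t` is finite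
and `|Γ ∩ B t| ≤ C · μ (B t)` for some `C > 0` and all sufficiently large `t`. -/
theorem lattice_points_upper_bound
    {G : Type*} [Group G] [TopologicalSpace G] [IsTopologicalGroup G]
    [LocallyCompactSpace G] [SecondCountableTopology G]
    [MeasurableSpace G] [BorelSpace G]
    (μ : Measure G) [μ.IsHaarMeasure]
    (Γ : Subgroup G) [DiscreteTopology Γ]
    (B : ℝ → Set G) (hB : CoarselyAdmissible μ B) :
    (∀ t : ℝ, 0 < t → ((Γ : Set G) ∩ B t).Finite) ∧
    ∃ C > (0:ℝ), ∀ᶠ t in atTop,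
      (((Γ : Set G) ∩ B t).ncard : ℝ≥0∞) ≤ ENNReal.ofReal C * μ (B t) := by
  have hfin : ∀ t : ℝ, 0 < t → ((Γ : Set G) ∩ B t).Finite := fun t ht =>
    finite_subgroup_inter_of_isCompact_closure Γ (hB.bounded t ht)
  refine ⟨hfin, ?_⟩
  obtain ⟨W, hW, h1W, hWΓ⟩ := exists_open_div_mem_eq_one Γ
  obtain ⟨Q, hQ, hQ1⟩ := exists_compact_mem_nhds (1 : G)
  have h1Q : (1 : G) ∈ Q := mem_of_mem_nhds hQ1
  set O : Set G := W ∩ interior Q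
  have hO : IsOpen O := hW.inter isOpen_interior
  have hOQ : O ⊆ Q := inter_subset_right.trans interior_subset
  have hO0 : μ O ≠ 0 :=
    (hO.measure_pos μ ⟨1, h1W, mem_interior_iff_mem_nhds.mpr hQ1⟩).ne'
  have hOtop : μ O ≠ ∞ := ((measure_mono hOQ).trans_lt hQ.measure_lt_top).ne
  obtain ⟨c, hc, htr⟩ := hB.translate Q hQ
  obtain ⟨d, hd, hgrow⟩ := hB.volume_growth c hc
  have hm : 0 < (μ O).toReal := ENNReal.toReal_pos hO0 hOtop
  refine ⟨d / (μ O).toReal, div_pos hd hm, ?_⟩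
  filter_upwards [htr, hgrow, eventually_gt_atTop 0] with t htt htg ht
  have hsub : ⋃ g ∈ (hfin t ht).toFinset, g • O ⊆ B (t + c) := by
    refine iUnion₂_subset fun g hg => ?_
    rintro _ ⟨x, hx, rfl⟩
    have hgB : g ∈ B t := ((hfin t ht).mem_toFinset.mp hg).2
    simpa using htt (mul_mem_mul (mul_mem_mul h1Q hgB) (hOQ hx))
  have hdisj : PairwiseDisjoint (↑(hfin t ht).toFinset) fun g : G => g • O := by
    intro a ha b hb hab
    refine disjoint_left.mpr ?_
    rintro _ ⟨x, hx, rfl⟩ ⟨y, hy, hxy⟩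
    simp only [Finite.coe_toFinset, mem_inter_iff, SetLike.mem_coe, smul_eq_mul] at ha hb hxy
    have hyx : y / x = b⁻¹ * a := by
      rw [div_eq_iff_eq_mul, mul_assoc, ← hxy, inv_mul_cancel_left]
    have h := hWΓ y hy.1 x hx.1 (hyx ▸ Γ.mul_mem (Γ.inv_mem hb.1) ha.1)
    rw [h] at hxy
    exact hab (mul_right_cancel hxy).symm
  have hsum : μ (⋃ g ∈ (hfin t ht).toFinset, g • O)
      = (((Γ : Set G) ∩ B t).ncard : ℝ≥0∞) * μ O := by
    rw [measure_biUnion_finset hdisj fun g _ => (hO.smul g).measurableSet]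
    simp [measure_smul, ncard_eq_toFinset_card _ (hfin t ht)]
  have hle := hsum ▸ (measure_mono hsub).trans htg
  rw [ENNReal.ofReal_div_of_pos hm, ENNReal.ofReal_toReal hOtop, ENNReal.mul_comm_div,
    ← mul_div_assoc, ENNReal.le_div_iff_mul_le (Or.inl hO0) (Or.inl hOtop)]
  exact hle
end

section
/- Let G be a locally compact second countable group with left Haar measure m_G, let Γ ≤ G be a lattice with m_G normalized so that a fundamental domain of Γ has measure 1, and let (G_t)_{t>0} be a coarsely admissible increasing family of bounded Borel subsets of G. Suppose the averages β_t satisfy the strong maximal inequality in (L^p(m_{G/Γ}), L^r(m_{G/Γ})) for some p ≥ r ≥ 1, for the left-translation action of G on (G/Γ, m_{G/Γ}). Then there exists C' > 0 such that |Γ ∩ G_t| ≥ C'·m_G(G_t) for all sufficiently large t. -/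
open MeasureTheory Filter Set Pointwise
open scoped ENNReal NNReal

/-- A discrete subgroup meets every relatively compact set in a finite set. -/
theorem Subgroup.finite_inter_of_isCompact_closure {G : Type*} [Group G] [TopologicalSpace G]
    [IsTopologicalGroup G] (Γ : Subgroup G) [DiscreteTopology Γ] {A : Set G}
    (hA : IsCompact (_root_.closure A)) : ((Γ : Set G) ∩ A).Finite := by
  obtain ⟨U, hU, hUΓ⟩ : ∃ U : Set G, IsOpen U ∧ ((↑) : Γ → G) ⁻¹' U = {1} :=
    isOpen_induced_iff.1 (isOpen_discrete ({1} : Set Γ))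
  have h1U : (1 : G) ∈ U := by
    have : (1 : Γ) ∈ ((↑) : Γ → G) ⁻¹' U := by rw [hUΓ]; rfl
    simpa using this
  have hN : (fun q : G × G => q.1⁻¹ * q.2) ⁻¹' U ∈ nhds ((1 : G), (1 : G)) :=
    (hU.preimage (by fun_prop)).mem_nhds (by simpa using h1U)
  obtain ⟨V, hV, h1V, hVU⟩ := exists_nhds_square hN
  obtain ⟨s, hs⟩ := hA.elim_finite_subcover (fun g : G => g • V)
    (fun g => hV.smul g) (fun g _ => mem_iUnion.2 ⟨g, 1, h1V, by simp⟩)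
  refine (s.finite_toSet.biUnion (t := fun g => (Γ : Set G) ∩ g • V) ?_).subset ?_
  · intro g _
    refine Set.Subsingleton.finite ?_
    rintro _ ⟨hx, v, hv, rfl⟩ _ ⟨hy, w, hw, rfl⟩
    have hm : (g • v)⁻¹ * (g • w) ∈ Γ := Γ.mul_mem (Γ.inv_mem hx) hy
    have hmU : (⟨_, hm⟩ : Γ) ∈ ((↑) : Γ → G) ⁻¹' U := by
      have : v⁻¹ * w ∈ U := hVU (mk_mem_prod hv hw)
      simpa [mul_assoc] using this
    rw [hUΓ] at hmU
    exact inv_mul_eq_one.1 (congrArg Subtype.val (mem_singleton_iff.1 hmU))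
  · rintro x ⟨hxΓ, hxA⟩
    obtain ⟨g, hg, hxg⟩ := mem_iUnion₂.1 (hs (_root_.subset_closure hxA))
    exact mem_iUnion₂.2 ⟨g, hg, hxΓ, hxg⟩

/-- A finite measure on a locally compact second countable group is concentrated, up to an
arbitrarily small mass, on a compact closed set. -/
theorem exists_isCompact_isClosed_measure_compl_lt {G : Type*} [Group G] [TopologicalSpace G]
    [IsTopologicalGroup G] [LocallyCompactSpace G] [SecondCountableTopology G]
    [MeasurableSpace G] [BorelSpace G] (m : Measure G) [IsFiniteMeasure m]
    {ε : ℝ≥0∞} (hε : 0 < ε) : ∃ Q : Set G, IsCompact Q ∧ IsClosed Q ∧ m Qᶜ < ε := by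
  let K := CompactExhaustion.choice G
  have hanti : Antitone fun n => (closure (K n))ᶜ := fun i j hij =>
    compl_subset_compl.2 (closure_mono (K.subset hij))
  have hempty : ⋂ n, (closure (K n))ᶜ = ∅ := by
    rw [← compl_iUnion, compl_empty_iff, eq_univ_iff_forall]
    intro x
    obtain ⟨n, hn⟩ := K.exists_mem x
    exact mem_iUnion.2 ⟨n, subset_closure hn⟩
  have hlim := tendsto_measure_iInter_atTop (μ := m)
    (fun n => (isClosed_closure (s := K n)).measurableSet.compl.nullMeasurableSet) hanti
    ⟨0, measure_ne_top _ _⟩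
  rw [hempty, measure_empty] at hlim
  obtain ⟨n, hn⟩ := (hlim.eventually (gt_mem_nhds hε)).exists
  exact ⟨_, (K.isCompact n).closure, isClosed_closure, hn⟩

/-- The image of a closed set in the quotient by a countable subgroup is measurable. -/
theorem QuotientGroup.measurableSet_image_mk_of_isClosed {G : Type*} [Group G]
    [TopologicalSpace G] [IsTopologicalGroup G] [MeasurableSpace G] [BorelSpace G]
    (Γ : Subgroup G) [Countable Γ] {Q : Set G} (hQ : IsClosed Q) :
    MeasurableSet ((QuotientGroup.mk : G → G ⧸ Γ) '' Q) := by
  change MeasurableSet ((QuotientGroup.mk : G → G ⧸ Γ) ⁻¹' _)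
  rw [QuotientGroup.preimage_image_mk_eq_iUnion_image]
  refine MeasurableSet.iUnion fun γ => ?_
  exact ((Homeomorph.mulRight (γ : G)).isClosedMap Q hQ).measurableSet

/-- If the average over `B t` of the indicator of the complement of the image of `Q` is at most
`1/2` at the coset of `h`, then `B t` has at most twice the volume of the translates of `Q⁻¹` by
the elements of `h * (Γ ∩ S)`, where `S` contains `h⁻¹ * B t * Q`. -/
theorem measure_le_of_abs_ergAvg_indicator_le {G : Type*} [Group G] [TopologicalSpace G]
    [IsTopologicalGroup G] [MeasurableSpace G] [BorelSpace G]
    (μ : Measure G) [μ.IsMulLeftInvariant] (Γ : Subgroup G) (B : ℝ → Set G)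
    {Q : Set G} (hQ : MeasurableSet ((QuotientGroup.mk : G → G ⧸ Γ) '' Q))
    {t : ℝ} (hfin : μ (B t) ≠ ∞) (h : G)
    {S : Set G} (hS : ∀ g ∈ B t, ∀ q ∈ Q, h⁻¹ * g * q ∈ S) (hΓS : ((Γ : Set G) ∩ S).Finite)
    (havg : |ergAvg μ B (indicator ((QuotientGroup.mk : G → G ⧸ Γ) '' Q)ᶜ fun _ => 1) t
      (h : G ⧸ Γ)| ≤ 1 / 2) :
    μ (B t) ≤ 2 * (((Γ : Set G) ∩ S).ncard * μ Q⁻¹) := by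
  set E : Set (G ⧸ Γ) := ((QuotientGroup.mk : G → G ⧸ Γ) '' Q)ᶜ
  set F : Set G := {g | g⁻¹ • (h : G ⧸ Γ) ∈ E}
  have hF : MeasurableSet F := by
    have hm : Measurable fun g : G => ((g⁻¹ * h : G) : G ⧸ Γ) :=
      measurable_quotient_mk''.comp
        (by fun_prop : Continuous fun g : G => g⁻¹ * h).measurable
    exact hm hQ.compl
  have hint : ∫ g in B t, E.indicator (fun _ => (1 : ℝ)) (g⁻¹ • (h : G ⧸ Γ)) ∂μ
      = μ.real (F ∩ B t) := by
    have : (fun g : G => E.indicator (fun _ => (1 : ℝ)) (g⁻¹ • (h : G ⧸ Γ)))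
        = F.indicator 1 := rfl
    rw [this, integral_indicator_one hF, measureReal_restrict_apply hF]
  have hhalf : 2 * μ.real (B t ∩ F) ≤ μ.real (B t) := by
    rw [ergAvg, hint, abs_of_nonneg (by positivity), inter_comm] at havg
    rcases (measureReal_nonneg (μ := μ) (s := B t)).eq_or_lt with h0 | hpos
    · have := measureReal_mono (μ := μ) (inter_subset_left : B t ∩ F ⊆ B t) hfin
      linarith
    · have := (inv_mul_le_iff₀ hpos).1 havg
      linarith
  have hcover : B t \ F ⊆ ⋃ γ ∈ hΓS.toFinset, (h * γ) • Q⁻¹ := by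
    rintro g ⟨hgB, hgF⟩
    have hg : ((g⁻¹ * h : G) : G ⧸ Γ) ∈ (QuotientGroup.mk : G → G ⧸ Γ) '' Q :=
      not_not.1 hgF
    obtain ⟨q, hq, hqg⟩ := hg
    have hγ : h⁻¹ * g * q ∈ Γ := by
      have := Γ.inv_mem (QuotientGroup.eq.1 hqg)
      simpa [mul_assoc] using this
    refine mem_iUnion₂.2 ⟨h⁻¹ * g * q, by simpa using ⟨hγ, hS g hgB q hq⟩, q⁻¹, by simpa, ?_⟩
    simp [mul_assoc]
  have hdiff : μ (B t \ F) ≤ ((Γ : Set G) ∩ S).ncard * μ Q⁻¹ := by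
    refine (measure_mono hcover).trans ((measure_biUnion_finset_le _ _).trans ?_)
    simp only [measure_smul, Finset.sum_const, nsmul_eq_mul, ncard_eq_toFinset_card _ hΓS, le_refl]
  have htwo : μ (B t) ≤ 2 * μ (B t \ F) := by
    have hsplit := measureReal_inter_add_sdiff (μ := μ) (s := B t) hF hfin
    have hne : μ (B t \ F) ≠ ∞ := measure_ne_top_of_subset sdiff_subset hfin
    rw [← ENNReal.toReal_le_toReal hfin (ENNReal.mul_ne_top (by simp) hne), ENNReal.toReal_mul]
    change μ.real (B t) ≤ 2 * μ.real (B t \ F)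
    linarith
  exact htwo.trans (by gcongr)

/-- **Lower bound for lattice points from the strong maximal inequality**
(Gorodnik–Nevo, Lemma 6.9(2)). Let `Γ` be a lattice in an lcsc group `G`, with Haar
measure normalized so that a fundamental domain `D` has measure `1`, and let `ν` be the
induced probability measure on `G/Γ`. If `(B t)` is coarsely admissible and the averages
`β_t` satisfy the strong maximal inequality in `(L^p(ν), L^r(ν))` for the translation
action of `G` on `G/Γ`, then `|Γ ∩ B t| ≥ C' · μ (B t)` for some `C' > 0` and all
sufficiently large `t`. -/
theorem lattice_points_lower_bound
    {G : Type*} [Group G] [TopologicalSpace G] [IsTopologicalGroup G]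
    [LocallyCompactSpace G] [SecondCountableTopology G]
    [MeasurableSpace G] [BorelSpace G]
    (μ : Measure G) [μ.IsHaarMeasure]
    (Γ : Subgroup G) [DiscreteTopology Γ]
    (D : Set G) (hD : IsFundamentalDomain Γ.op D μ) (hD1 : μ D = 1)
    (ν : Measure (G ⧸ Γ)) [IsProbabilityMeasure ν]
    (hν : ν = Measure.map (QuotientGroup.mk : G → G ⧸ Γ) (μ.restrict D))
    (B : ℝ → Set G) (hB : CoarselyAdmissible μ B)
    (p r : ℝ) (hr : 1 ≤ r) (hpr : r ≤ p)
    (hmax : ∃ t₀ ≥ (0:ℝ), ∃ C > (0:ℝ), ∀ f : G ⧸ Γ → ℝ, MemLp f (ENNReal.ofReal p) ν →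
      (∫⁻ x, (⨆ (t : ℝ) (_ : t₀ < t), ENNReal.ofReal |ergAvg μ B f t x|) ^ r ∂ν) ^ (1/r)
        ≤ ENNReal.ofReal C * eLpNorm f (ENNReal.ofReal p) ν) :
    ∃ C' > (0:ℝ), ∀ᶠ t in atTop,
      ENNReal.ofReal C' * μ (B t) ≤ (((Γ : Set G) ∩ B t).ncard : ℝ≥0∞) := by
  obtain ⟨t₀, -, C, hC, hmax⟩ := hmax
  have hr0 : 0 < r := by linarith
  have hp0 : 0 < p := by linarith
  have : Countable Γ := TopologicalSpace.separableSpace_iff_countable.1 inferInstance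
  have : IsFiniteMeasure (μ.restrict D) := ⟨by simp [hD1]⟩
  obtain ⟨Q, hQ, hQc, hQε⟩ := exists_isCompact_isClosed_measure_compl_lt (μ.restrict D)
    (ENNReal.ofReal_pos.2 (by positivity : (0 : ℝ) < (1 / (2 * C)) ^ p))
  have hQm : MeasurableSet ((QuotientGroup.mk : G → G ⧸ Γ) '' Q) :=
    QuotientGroup.measurableSet_image_mk_of_isClosed Γ hQc
  set E : Set (G ⧸ Γ) := ((QuotientGroup.mk : G → G ⧸ Γ) '' Q)ᶜ
  have hνE : ν E < ENNReal.ofReal ((1 / (2 * C)) ^ p) := by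
    rw [hν, Measure.map_apply measurable_quotient_mk'' hQm.compl]
    exact (measure_mono (compl_subset_compl.2 (subset_preimage_image _ Q))).trans_lt hQε
  -- Some orbit visits the image of `Q` at least half of the time.
  obtain ⟨x, hx⟩ : ∃ x, ∀ t > t₀, |ergAvg μ B (E.indicator fun _ => 1) t x| ≤ 1 / 2 := by
    by_contra! hcon
    have hnorm := hmax (E.indicator fun _ => 1)
      (memLp_indicator_const _ hQm.compl _ (Or.inr (measure_ne_top _ _)))
    refine absurd hnorm (not_le.2 ?_)
    have hlow : ENNReal.ofReal (1 / 2) ≤ (∫⁻ x, (⨆ (t : ℝ) (_ : t₀ < t),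
        ENNReal.ofReal |ergAvg μ B (E.indicator fun _ => 1) t x|) ^ r ∂ν) ^ (1 / r) := by
      rw [one_div r, ENNReal.le_rpow_inv_iff hr0]
      calc ENNReal.ofReal (1 / 2) ^ r = ∫⁻ _, ENNReal.ofReal (1 / 2) ^ r ∂ν := by simp
        _ ≤ _ := by
          refine lintegral_mono fun x => ENNReal.rpow_le_rpow ?_ hr0.le
          obtain ⟨t, ht, hlt⟩ := hcon x
          exact (ENNReal.ofReal_le_ofReal hlt.le).trans (le_iSup₂_of_le t ht le_rfl)
    refine lt_of_lt_of_le ?_ hlow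
    rw [eLpNorm_indicator_const hQm.compl (by simpa using hp0) (by simp),
      ENNReal.toReal_ofReal hp0.le, enorm_one, one_mul]
    have hroot : ν E ^ (1 / p) < ENNReal.ofReal (1 / (2 * C)) := by
      rw [one_div p, ENNReal.rpow_inv_lt_iff hp0,
        ENNReal.ofReal_rpow_of_nonneg (by positivity) hp0.le]
      exact hνE
    calc ENNReal.ofReal C * ν E ^ (1 / p)
        < ENNReal.ofReal C * ENNReal.ofReal (1 / (2 * C)) :=
          ENNReal.mul_lt_mul_right (by simpa using hC) (by simp) hroot
      _ = ENNReal.ofReal (1 / 2) := by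
          rw [← ENNReal.ofReal_mul hC.le]
          congr 1
          field_simp
  obtain ⟨h, rfl⟩ := QuotientGroup.mk_surjective x
  obtain ⟨c, hc, hBc⟩ := hB.translate ({h⁻¹} ∪ Q) (isCompact_singleton.union hQ)
  obtain ⟨d, hd, hBd⟩ := hB.volume_growth c hc
  set M : ℝ := μ.real Q⁻¹ + 1
  have hM : 0 < M := by positivity
  have hQM : μ Q⁻¹ ≤ ENNReal.ofReal M := by
    rw [← ofReal_measureReal hQ.inv.measure_lt_top.ne]
    exact ENNReal.ofReal_le_ofReal (by simp [M])
  refine ⟨1 / (d * (2 * M)), by positivity, ?_⟩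
  have key : ∀ᶠ t in atTop, ENNReal.ofReal (1 / (d * (2 * M))) * μ (B (t + c))
      ≤ (((Γ : Set G) ∩ B (t + c)).ncard : ℝ≥0∞) := by
    filter_upwards [hBc, hBd, eventually_gt_atTop t₀, eventually_gt_atTop 0] with t ht hdt htt ht0
    have hvol : μ (B t) ≤ 2 * (((Γ : Set G) ∩ B (t + c)).ncard * μ Q⁻¹) :=
      measure_le_of_abs_ergAvg_indicator_le μ Γ B hQm
        (measure_ne_top_of_subset subset_closure (hB.bounded t ht0).measure_lt_top.ne) h
        (fun g hg q hq => ht (mul_mem_mul (mul_mem_mul (Or.inl rfl) hg) (Or.inr hq)))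
        (Γ.finite_inter_of_isCompact_closure (hB.bounded _ (by positivity))) (hx t htt)
    set n : ℝ≥0∞ := (((Γ : Set G) ∩ B (t + c)).ncard : ℝ≥0∞)
    calc ENNReal.ofReal (1 / (d * (2 * M))) * μ (B (t + c))
        ≤ ENNReal.ofReal (1 / (d * (2 * M))) *
            (ENNReal.ofReal d * (2 * (n * ENNReal.ofReal M))) := by
          refine mul_le_mul_right (hdt.trans (mul_le_mul_right (hvol.trans ?_) _)) _
          gcongr
      _ = ENNReal.ofReal (1 / (d * (2 * M))) *
            (ENNReal.ofReal d * (ENNReal.ofReal 2 * ENNReal.ofReal M)) * n := by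
          rw [ENNReal.ofReal_ofNat]
          ring
      _ = n := by
          rw [← ENNReal.ofReal_mul zero_le_two, ← ENNReal.ofReal_mul hd.le,
            ← ENNReal.ofReal_mul (by positivity), one_div_mul_cancel (by positivity),
            ENNReal.ofReal_one, one_mul]
  filter_upwards [(tendsto_atTop_add_const_right atTop (-c) tendsto_id).eventually key] with t ht
  simpa using ht
end

section
/- Equidistribution from the mean ergodic theorem in isometric actions: let Γ be a countable group acting by isometries on a compact metric space (S, d) and preserving a Borel probability measure m whose support is all of S. Let (λ_t)_{t>0} be a family of probability measures on Γ, and for f : S → ℝ set π(λ_t)f(s) = Σ_{γ∈Γ} λ_t({γ})·f(γ⁻¹·s). Suppose that for every f ∈ L²(S, m), ‖π(λ_t)f − ∫_S f dm‖_{L²(m)} → 0 as t → ∞ (the mean ergodic theorem in L²(S,m)). Then for every continuous function f on S, π(λ_t)f converges uniformly on S to the constant ∫_S f dm; in particular π(λ_t)f(s) → ∫_S f dm for every point s ∈ S. -/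
open MeasureTheory Filter Set
open scoped ENNReal NNReal

/-- The averaging operator `π(λ_t) f (s) = Σ_{γ ∈ Γ} λ_t({γ}) f(γ⁻¹ • s)` associated to a
family of probability measures `λ_t` on a countable group `Γ` acting on a space `S`. -/
noncomputable def discAvg {Γ S : Type*} [Group Γ] [MeasurableSpace Γ] [MulAction Γ S]
    (lam : ℝ → Measure Γ) (f : S → ℝ) (t : ℝ) (s : S) : ℝ :=
  ∑' γ : Γ, (lam t {γ}).toReal * f (γ⁻¹ • s)

/-- A function whose modulus is at least `c` on a measurable set `A` has `L²` norm at least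
`c * m(A)^{1/2}`; no measurability of the function is needed. -/
theorem mul_rpow_measure_le_eLpNorm_two {S : Type*} [MeasurableSpace S] {m : Measure S}
    {A : Set S} (hA : MeasurableSet A) {g : S → ℝ} {c : ℝ} (hc : 0 ≤ c)
    (h : ∀ y ∈ A, c ≤ |g y|) :
    ENNReal.ofReal c * m A ^ (1 / 2 : ℝ) ≤ eLpNorm g 2 m := by
  have h1 : eLpNorm (A.indicator fun _ => c) 2 m ≤ eLpNorm g 2 m := by
    refine eLpNorm_mono fun y => ?_
    by_cases hy : y ∈ A
    · simpa [hy, abs_of_nonneg hc] using h y hy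
    · simp [hy]
  rw [eLpNorm_indicator_const hA (by norm_num) (by norm_num)] at h1
  simpa [Real.enorm_eq_ofReal hc] using h1

/-- If the weights are summable with sum at most `2`, averaging at most doubles the oscillation of
a continuous function between two points at distance less than `δ`. -/
theorem abs_discAvg_sub_le {Γ S : Type*} [Group Γ] [MeasurableSpace Γ]
    [MetricSpace S] [CompactSpace S] [MulAction Γ S]
    (hiso : ∀ γ : Γ, Isometry (fun s : S => γ • s)) {lam : ℝ → Measure Γ} {t : ℝ}
    (hsum : Summable fun γ : Γ => (lam t {γ}).toReal)
    (hle : ∑' γ : Γ, (lam t {γ}).toReal ≤ 2)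
    {f : S → ℝ} (hf : Continuous f) {ε δ : ℝ} (hε : 0 ≤ ε)
    (hfδ : ∀ x y : S, dist x y < δ → |f x - f y| ≤ ε) {x y : S} (hxy : dist x y < δ) :
    |discAvg lam f t x - discAvg lam f t y| ≤ 2 * ε := by
  obtain ⟨C, hC⟩ := isCompact_univ.exists_bound_of_continuousOn hf.continuousOn
  have hs (z : S) : Summable fun γ : Γ => (lam t {γ}).toReal * f (γ⁻¹ • z) := by
    refine Summable.of_norm_bounded (hsum.mul_right C) fun γ => ?_
    rw [norm_mul, Real.norm_of_nonneg ENNReal.toReal_nonneg]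
    exact mul_le_mul_of_nonneg_left (hC _ (mem_univ _)) ENNReal.toReal_nonneg
  unfold discAvg
  rw [← (hs x).tsum_sub (hs y), ← Real.norm_eq_abs]
  refine (tsum_of_norm_bounded (hsum.mul_right ε).hasSum fun γ => ?_).trans ?_
  · rw [← mul_sub, norm_mul, Real.norm_of_nonneg ENNReal.toReal_nonneg]
    refine mul_le_mul_of_nonneg_left (hfδ _ _ ?_) ENNReal.toReal_nonneg
    rwa [(hiso γ⁻¹).dist_eq]
  · rw [tsum_mul_right]
    exact mul_le_mul_of_nonneg_right hle hε

/-- The mean ergodic theorem for the constant function `1` forces the total weight to tend to `1`.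
As `Γ` may have non-measurable singletons, this is not automatic. -/
theorem tendsto_tsum_weights {Γ S : Type*} [Group Γ] [MeasurableSpace Γ] [MeasurableSpace S]
    [MulAction Γ S] {m : Measure S} [IsProbabilityMeasure m] {lam : ℝ → Measure Γ}
    (hone : Tendsto (fun t : ℝ =>
      eLpNorm (fun s : S => discAvg lam (fun _ : S => (1 : ℝ)) t s - ∫ _, (1 : ℝ) ∂m) 2 m)
      atTop (nhds 0)) :
    Tendsto (fun t : ℝ => ∑' γ : Γ, (lam t {γ}).toReal) atTop (nhds 1) := by
  rw [tendsto_iff_edist_tendsto_0]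
  refine hone.congr fun t => ?_
  simp only [discAvg, mul_one, integral_const, probReal_univ, smul_eq_mul]
  rw [eLpNorm_const _ (by norm_num) (IsProbabilityMeasure.ne_zero m), measure_univ,
    ENNReal.one_rpow, mul_one, edist_eq_enorm_sub]

/-- **Equidistribution from the mean ergodic theorem in isometric actions**
(Gorodnik–Nevo, Proposition 6.22). Let a countable group `Γ` act by isometries on a
compact metric space `S`, preserving a Borel probability measure `m` of full support.
If a family `λ_t` of probability measures on `Γ` satisfies the mean ergodic theorem in
`L²(S, m)`, then for every continuous `f : S → ℝ` the averages `π(λ_t) f` converge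
uniformly on `S` to the constant `∫ f dm`; in particular they converge at every point. -/
theorem equidistribution_of_mean_ergodic
    {Γ S : Type*} [Group Γ] [Countable Γ] [MeasurableSpace Γ]
    [MetricSpace S] [CompactSpace S] [MeasurableSpace S] [BorelSpace S]
    [MulAction Γ S]
    (hiso : ∀ γ : Γ, Isometry (fun s : S => γ • s))
    (m : Measure S) [IsProbabilityMeasure m] [SMulInvariantMeasure Γ S m]
    [m.IsOpenPosMeasure]
    (lam : ℝ → Measure Γ) (hlam : ∀ t : ℝ, IsProbabilityMeasure (lam t))
    (hmean : ∀ f : S → ℝ, MemLp f 2 m →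
      Tendsto (fun t : ℝ =>
          eLpNorm (fun s => discAvg lam f t s - ∫ x, f x ∂m) 2 m) atTop (nhds 0)) :
    ∀ f : S → ℝ, Continuous f →
      TendstoUniformly (fun t s => discAvg lam f t s) (fun _ => ∫ x, f x ∂m) atTop ∧
      ∀ s : S, Tendsto (fun t : ℝ => discAvg lam f t s) atTop (nhds (∫ x, f x ∂m)) := by
  intro f hf
  have key : TendstoUniformly (fun t s => discAvg lam f t s) (fun _ => ∫ x, f x ∂m) atTop := by
    rw [Metric.tendstoUniformly_iff]
    intro ε hε
    have hW := tendsto_tsum_weights (hmean (fun _ => 1) (memLp_const 1))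
    obtain ⟨δ, hδ, hfδ⟩ := Metric.uniformContinuous_iff.1
      (CompactSpace.uniformContinuous_of_continuous hf) (ε / 8) (by positivity)
    obtain ⟨F, -, hF, hcover⟩ := finite_cover_balls_of_compact (isCompact_univ (X := S))
      (half_pos hδ)
    have hsmall : ∀ᶠ t in atTop, ∀ z ∈ F,
        eLpNorm (fun s => discAvg lam f t s - ∫ x, f x ∂m) 2 m <
          ENNReal.ofReal (ε / 2) * m (Metric.ball z (δ / 2)) ^ (1 / 2 : ℝ) := by
      refine (eventually_all_finite hF).2 fun z _ => ?_
      refine (hmean f (hf.memLp_of_hasCompactSupport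
        (HasCompactSupport.of_compactSpace f))).eventually_lt_const ?_
      refine ENNReal.mul_pos (by simpa using hε) ?_
      exact (ENNReal.rpow_pos (Metric.measure_ball_pos m z (half_pos hδ))
        (measure_ne_top _ _)).ne'
    filter_upwards [hsmall, hW.eventually_const_lt one_pos, hW.eventually_le_const one_lt_two]
      with t ht hpos hle x
    have hsum : Summable fun γ : Γ => (lam t {γ}).toReal := by
      by_contra h
      exact hpos.ne' (tsum_eq_zero_of_not_summable h)
    obtain ⟨z, hz, hxz⟩ := mem_iUnion₂.1 (hcover (mem_univ x))
    obtain ⟨y, hy, hyI⟩ : ∃ y ∈ Metric.ball z (δ / 2),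
        |discAvg lam f t y - ∫ x, f x ∂m| < ε / 2 := by
      by_contra! h
      exact (ht z hz).not_ge
        (mul_rpow_measure_le_eLpNorm_two measurableSet_ball (half_pos hε).le h)
    have hxy : dist x y < δ := by
      have := dist_triangle_right x y z
      rw [Metric.mem_ball] at hxz hy
      linarith
    have hosc := abs_discAvg_sub_le hiso hsum hle hf (by positivity)
      (fun a b hab => (hfδ hab).le) hxy
    rw [dist_comm, Real.dist_eq]
    have := abs_sub_le (discAvg lam f t x) (discAvg lam f t y) (∫ x, f x ∂m)
    linarith
  exact ⟨key, fun s => key.tendsto_at s⟩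
end

section
/- Let G₁, G₂ be locally compact second countable noncompact groups with Haar measures, and let d_i : G_i → [t₀,∞) be proper continuous functions. Set v_i(t) = vol({g ∈ G_i : d_i(g) < t}) and v(t) = vol({(g₁,g₂) ∈ G₁×G₂ : d₁(g₁) + d₂(g₂) < t}) (product Haar measure). Suppose there exist c > 0 and s₀ > t₀ such that for all sufficiently small ε > 0 and all t > s₀, v_i(t+ε) ≤ (1+cε)·v_i(t) for i = 1, 2. Then for all sufficiently small ε > 0 and all t > 2s₀ + 2, v(t+ε) ≤ (1+3cε)·v(t). -/
open MeasureTheory Filter Set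
open scoped ENNReal NNReal

/-- If `μ {d < t + ε} ≤ (1 + δ) μ {d < t} < ∞`, the shell `{t ≤ d < t + ε}` has measure at most
`δ μ {d < t}`. -/
lemma measure_shell_le {α : Type*} [MeasurableSpace α] {μ : Measure α} {d : α → ℝ}
    (hd : Measurable d) {t ε δ : ℝ} (hε : 0 ≤ ε) (hδ : 0 ≤ δ) (hfin : μ {x | d x < t} ≠ ∞)
    (h : μ {x | d x < t + ε} ≤ ENNReal.ofReal (1 + δ) * μ {x | d x < t}) :
    μ {x | t ≤ d x ∧ d x < t + ε} ≤ ENNReal.ofReal δ * μ {x | d x < t} := by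
  have hset : {x | t ≤ d x ∧ d x < t + ε} = {x | d x < t + ε} \ {x | d x < t} := by
    ext x
    simp only [mem_ofPred_eq, Set.mem_sdiff, not_lt]
    tauto
  have hsub : {x | d x < t} ⊆ {x | d x < t + ε} := fun x hx => by
    simp only [mem_ofPred_eq] at hx ⊢
    linarith
  rw [hset, measure_sdiff hsub (measurableSet_lt hd measurable_const).nullMeasurableSet hfin]
  refine tsub_le_iff_left.2 (h.trans_eq ?_)
  rw [ENNReal.ofReal_add zero_le_one hδ, ENNReal.ofReal_one, add_mul, one_mul]

/-- Integrating a shell bound for `g` over the fibres of a product. -/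
lemma measure_prod_shell_le {α β : Type*} [MeasurableSpace α] [MeasurableSpace β]
    (μ : Measure α) (ν : Measure β) [SFinite ν] {f : α → ℝ} {g : β → ℝ}
    (hf : Measurable f) (hg : Measurable g) {s ε : ℝ} (t : ℝ) {k : ℝ≥0∞}
    (h : ∀ r > s, ν {y | r ≤ g y ∧ g y < r + ε} ≤ k * ν {y | g y < r}) :
    μ.prod ν {x | s < t - f x.1 ∧ t ≤ f x.1 + g x.2 ∧ f x.1 + g x.2 < t + ε}
      ≤ k * μ.prod ν {x | f x.1 + g x.2 < t} := by
  have hfg : Measurable fun x : α × β => f x.1 + g x.2 := by fun_prop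
  have hf' : Measurable fun x : α × β => t - f x.1 := by fun_prop
  have hlt : MeasurableSet {x : α × β | f x.1 + g x.2 < t} :=
    measurableSet_lt hfg measurable_const
  have hshell : MeasurableSet
      {x : α × β | s < t - f x.1 ∧ t ≤ f x.1 + g x.2 ∧ f x.1 + g x.2 < t + ε} :=
    (measurableSet_lt measurable_const hf').inter
      ((measurableSet_le measurable_const hfg).inter (measurableSet_lt hfg measurable_const))
  rw [Measure.prod_apply hshell, Measure.prod_apply hlt,
    ← lintegral_const_mul _ (measurable_measure_prodMk_left hlt)]
  refine lintegral_mono fun x => ?_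
  by_cases hx : s < t - f x
  · refine (measure_mono fun y hy => ?_).trans ((h _ hx).trans_eq ?_)
    · simp only [mem_preimage, mem_ofPred_eq] at hy ⊢
      constructor <;> linarith
    · simp only [preimage_ofPred_eq, lt_sub_iff_add_lt']
  · simp [hx]

/-- **Lipschitz volume regularity passes to products** (Gorodnik–Nevo, Proposition 8.4).
Let `G₁, G₂` be lcsc noncompact groups with Haar measures `μ₁, μ₂` and `d_i : G_i → [t₀,∞)`
proper continuous functions, with `v_i(t) = vol {d_i < t}` and
`v(t) = vol {(g₁,g₂) : d₁(g₁) + d₂(g₂) < t}`. If there are `c > 0` and `s₀ > t₀` with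
`v_i(t+ε) ≤ (1+cε) v_i(t)` for all small `ε > 0` and `t > s₀`, then
`v(t+ε) ≤ (1+3cε) v(t)` for all small `ε > 0` and `t > 2s₀ + 2`. -/
theorem product_volume_lipschitz
    {G₁ G₂ : Type*}
    [Group G₁] [TopologicalSpace G₁] [IsTopologicalGroup G₁]
    [LocallyCompactSpace G₁] [SecondCountableTopology G₁] [NoncompactSpace G₁]
    [MeasurableSpace G₁] [BorelSpace G₁]
    [Group G₂] [TopologicalSpace G₂] [IsTopologicalGroup G₂]
    [LocallyCompactSpace G₂] [SecondCountableTopology G₂] [NoncompactSpace G₂]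
    [MeasurableSpace G₂] [BorelSpace G₂]
    (μ₁ : Measure G₁) [μ₁.IsHaarMeasure] (μ₂ : Measure G₂) [μ₂.IsHaarMeasure]
    (t₀ : ℝ) (d₁ : G₁ → ℝ) (d₂ : G₂ → ℝ)
    (hd₁_cont : Continuous d₁) (hd₂_cont : Continuous d₂)
    (hd₁_lb : ∀ g, t₀ ≤ d₁ g) (hd₂_lb : ∀ g, t₀ ≤ d₂ g)
    (hd₁_proper : ∀ t : ℝ, IsCompact {g : G₁ | d₁ g ≤ t})
    (hd₂_proper : ∀ t : ℝ, IsCompact {g : G₂ | d₂ g ≤ t})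
    (c s₀ : ℝ) (hc : 0 < c) (hs₀ : t₀ < s₀)
    (hreg : ∃ ε₀ > (0:ℝ), ∀ ε : ℝ, 0 < ε → ε < ε₀ → ∀ t > s₀,
      μ₁ {g | d₁ g < t + ε} ≤ ENNReal.ofReal (1 + c * ε) * μ₁ {g | d₁ g < t} ∧
      μ₂ {g | d₂ g < t + ε} ≤ ENNReal.ofReal (1 + c * ε) * μ₂ {g | d₂ g < t}) :
    ∃ ε₁ > (0:ℝ), ∀ ε : ℝ, 0 < ε → ε < ε₁ → ∀ t > 2 * s₀ + 2,
      (μ₁.prod μ₂) {x : G₁ × G₂ | d₁ x.1 + d₂ x.2 < t + ε}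
        ≤ ENNReal.ofReal (1 + 3 * c * ε) * (μ₁.prod μ₂) {x : G₁ × G₂ | d₁ x.1 + d₂ x.2 < t} := by
  obtain ⟨ε₀, hε₀, hreg⟩ := hreg
  refine ⟨min ε₀ 2, by positivity, fun ε hε hlt t ht => ?_⟩
  obtain ⟨hεε₀, hε2⟩ := lt_min_iff.1 hlt
  have hcε : 0 ≤ c * ε := by positivity
  have fin₁ (r : ℝ) : μ₁ {g | d₁ g < r} ≠ ∞ :=
    measure_ne_top_of_subset (ofPred_subset_ofPred_of_imp fun _ hg => hg.le)
      (hd₁_proper r).measure_ne_top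
  have fin₂ (r : ℝ) : μ₂ {g | d₂ g < r} ≠ ∞ :=
    measure_ne_top_of_subset (ofPred_subset_ofPred_of_imp fun _ hg => hg.le)
      (hd₂_proper r).measure_ne_top
  have shell₂ := measure_prod_shell_le μ₁ μ₂ hd₁_cont.measurable hd₂_cont.measurable t
    fun r hr => measure_shell_le hd₂_cont.measurable hε.le hcε (fin₂ r) (hreg ε hε hεε₀ r hr).2
  have shell₁ := measure_prod_shell_le μ₂ μ₁ hd₂_cont.measurable hd₁_cont.measurable t
    fun r hr => measure_shell_le hd₁_cont.measurable hε.le hcε (fin₁ r) (hreg ε hε hεε₀ r hr).1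
  have hswap (S : Set (G₂ × G₁)) : μ₂.prod μ₁ S = μ₁.prod μ₂ (Prod.swap ⁻¹' S) :=
    (Measure.measurePreserving_swap.measure_preimage_equiv
      (f := MeasurableEquiv.prodComm) S).symm
  rw [hswap, hswap] at shell₁
  simp only [preimage_ofPred_eq, Prod.fst_swap, Prod.snd_swap, add_comm (d₂ _)] at shell₁
  calc (μ₁.prod μ₂) {x | d₁ x.1 + d₂ x.2 < t + ε}
    _ ≤ (μ₁.prod μ₂) ({x | d₁ x.1 + d₂ x.2 < t} ∪
          ({x | s₀ < t - d₂ x.2 ∧ t ≤ d₁ x.1 + d₂ x.2 ∧ d₁ x.1 + d₂ x.2 < t + ε} ∪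
           {x | s₀ < t - d₁ x.1 ∧ t ≤ d₁ x.1 + d₂ x.2 ∧ d₁ x.1 + d₂ x.2 < t + ε})) := by
        refine measure_mono fun x hx => ?_
        simp only [mem_union, mem_ofPred_eq] at hx ⊢
        by_cases h : d₁ x.1 + d₂ x.2 < t
        · exact Or.inl h
        · rw [not_lt] at h
          by_cases h' : s₀ < t - d₂ x.2
          · exact Or.inr (Or.inl ⟨h', h, hx⟩)
          · exact Or.inr (Or.inr ⟨by linarith, h, hx⟩)
    _ ≤ _ := (measure_union_le _ _).trans (add_le_add_right (measure_union_le _ _) _)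
    _ ≤ _ := add_le_add_right (add_le_add shell₁ shell₂) _
    _ = ENNReal.ofReal (1 + (c * ε + c * ε)) * (μ₁.prod μ₂) {x | d₁ x.1 + d₂ x.2 < t} := by
        rw [ENNReal.ofReal_add zero_le_one (by positivity), ENNReal.ofReal_add hcε hcε,
          ENNReal.ofReal_one, add_mul, add_mul, one_mul]
    _ ≤ _ := by
        gcongr
        linarith
end

section
/- Let G₁, G₂ be locally compact second countable noncompact groups with Haar measures, and let d_i : G_i → [t₀,∞) be proper continuous functions. Set v_i(t) = vol({g ∈ G_i : d_i(g) < t}) and v(t) = vol({(g₁,g₂) ∈ G₁×G₂ : d₁(g₁) + d₂(g₂) < t}) (product Haar measure). Suppose there exist c > 0 and s₀ > t₀ such that for all t > s₀, v_i(t+1) ≤ c·v_i(t) for i = 1, 2. Then for all t > 2s₀ + 2, v(t+1) ≤ (1+3c)·v(t). -/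
open MeasureTheory Filter Set
open scoped ENNReal NNReal

/-- If the sublevel sets of `f` grow by at most a factor `C` from height `t` to `t + 1` whenever
`t > s`, then so do the sublevel sets of `(a, b) ↦ e a + f b`, restricted to
`e a < t - s`. -/
theorem prod_sublevel_fst_le {α β : Type*} [MeasurableSpace α] [MeasurableSpace β]
    (μ : Measure α) (ν : Measure β) [SFinite ν] {e : α → ℝ} {f : β → ℝ}
    (he : Measurable e) (hf : Measurable f) {C : ℝ≥0∞} {s : ℝ}
    (h : ∀ t > s, ν {b | f b < t + 1} ≤ C * ν {b | f b < t}) (t : ℝ) :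
    (μ.prod ν) {x : α × β | e x.1 + f x.2 < t + 1 ∧ e x.1 < t - s}
      ≤ C * (μ.prod ν) {x : α × β | e x.1 + f x.2 < t} := by
  have hsum : Measurable fun x : α × β => e x.1 + f x.2 :=
    (he.comp measurable_fst).add (hf.comp measurable_snd)
  have hlow : MeasurableSet {x : α × β | e x.1 + f x.2 < t} :=
    measurableSet_lt hsum measurable_const
  have hhigh : MeasurableSet {x : α × β | e x.1 + f x.2 < t + 1 ∧ e x.1 < t - s} :=
    (measurableSet_lt hsum measurable_const).inter
      (measurableSet_lt (he.comp measurable_fst) measurable_const)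
  rw [Measure.prod_apply hhigh, Measure.prod_apply hlow,
    ← lintegral_const_mul _ (measurable_measure_prodMk_left hlow)]
  refine lintegral_mono fun a => ?_
  by_cases ha : e a < t - s
  · calc ν (Prod.mk a ⁻¹' {x : α × β | e x.1 + f x.2 < t + 1 ∧ e x.1 < t - s})
        ≤ ν {b | f b < t - e a + 1} :=
          measure_mono fun b hb => by
            have := hb.1
            simp only [mem_ofPred_eq] at this ⊢
            linarith
      _ ≤ C * ν {b | f b < t - e a} := h _ (by linarith)
      _ ≤ C * ν (Prod.mk a ⁻¹' {x : α × β | e x.1 + f x.2 < t}) := by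
          gcongr
          intro b hb
          simp only [mem_ofPred_eq, mem_preimage] at hb ⊢
          linarith
  · simp [ha]

/-- **Coarse volume regularity passes to products** (Gorodnik–Nevo, Proposition 8.5).
Let `G₁, G₂` be lcsc noncompact groups with Haar measures `μ₁, μ₂` and `d_i : G_i → [t₀,∞)`
proper continuous functions, with `v_i(t) = vol {d_i < t}` and
`v(t) = vol {(g₁,g₂) : d₁(g₁) + d₂(g₂) < t}`. If there are `c > 0` and `s₀ > t₀` with
`v_i(t+1) ≤ c · v_i(t)` for all `t > s₀`, then `v(t+1) ≤ (1+3c) v(t)` for all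
`t > 2s₀ + 2`. -/
theorem product_volume_doubling
    {G₁ G₂ : Type*}
    [Group G₁] [TopologicalSpace G₁] [IsTopologicalGroup G₁]
    [LocallyCompactSpace G₁] [SecondCountableTopology G₁] [NoncompactSpace G₁]
    [MeasurableSpace G₁] [BorelSpace G₁]
    [Group G₂] [TopologicalSpace G₂] [IsTopologicalGroup G₂]
    [LocallyCompactSpace G₂] [SecondCountableTopology G₂] [NoncompactSpace G₂]
    [MeasurableSpace G₂] [BorelSpace G₂]
    (μ₁ : Measure G₁) [μ₁.IsHaarMeasure] (μ₂ : Measure G₂) [μ₂.IsHaarMeasure]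
    (t₀ : ℝ) (d₁ : G₁ → ℝ) (d₂ : G₂ → ℝ)
    (hd₁_cont : Continuous d₁) (hd₂_cont : Continuous d₂)
    (hd₁_lb : ∀ g, t₀ ≤ d₁ g) (hd₂_lb : ∀ g, t₀ ≤ d₂ g)
    (hd₁_proper : ∀ t : ℝ, IsCompact {g : G₁ | d₁ g ≤ t})
    (hd₂_proper : ∀ t : ℝ, IsCompact {g : G₂ | d₂ g ≤ t})
    (c s₀ : ℝ) (hc : 0 < c) (hs₀ : t₀ < s₀)
    (hreg : ∀ t > s₀,
      μ₁ {g | d₁ g < t + 1} ≤ ENNReal.ofReal c * μ₁ {g | d₁ g < t} ∧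
      μ₂ {g | d₂ g < t + 1} ≤ ENNReal.ofReal c * μ₂ {g | d₂ g < t}) :
    ∀ t > 2 * s₀ + 2,
      (μ₁.prod μ₂) {x : G₁ × G₂ | d₁ x.1 + d₂ x.2 < t + 1}
        ≤ ENNReal.ofReal (1 + 3 * c) * (μ₁.prod μ₂) {x : G₁ × G₂ | d₁ x.1 + d₂ x.2 < t} := by
  intro t ht
  set S : Set (G₁ × G₂) := {x | d₁ x.1 + d₂ x.2 < t}
  set A : Set (G₁ × G₂) := {x | d₁ x.1 + d₂ x.2 < t + 1 ∧ d₁ x.1 < t - s₀}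
  set B : Set (G₂ × G₁) := {x | d₂ x.1 + d₁ x.2 < t + 1 ∧ d₂ x.1 < t - s₀}
  have hA : (μ₁.prod μ₂) A ≤ ENNReal.ofReal c * (μ₁.prod μ₂) S :=
    prod_sublevel_fst_le μ₁ μ₂ hd₁_cont.measurable hd₂_cont.measurable
      (fun u hu => (hreg u hu).2) t
  have hswap : MeasurePreserving (MeasurableEquiv.prodComm : G₁ × G₂ ≃ᵐ G₂ × G₁)
      (μ₁.prod μ₂) (μ₂.prod μ₁) := Measure.measurePreserving_swap
  have hB : (μ₁.prod μ₂) (Prod.swap ⁻¹' B) ≤ ENNReal.ofReal c * (μ₁.prod μ₂) S := by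
    have hS : Prod.swap ⁻¹' {x : G₂ × G₁ | d₂ x.1 + d₁ x.2 < t} = S := by
      ext x
      simp [S, add_comm]
    rw [← hS]
    refine (hswap.measure_preimage_equiv B).trans_le ?_
    refine (prod_sublevel_fst_le μ₂ μ₁ hd₂_cont.measurable hd₁_cont.measurable
      (fun u hu => (hreg u hu).1) t).trans_eq ?_
    exact congrArg _ (hswap.measure_preimage_equiv _).symm
  calc (μ₁.prod μ₂) {x : G₁ × G₂ | d₁ x.1 + d₂ x.2 < t + 1}
      ≤ (μ₁.prod μ₂) (A ∪ Prod.swap ⁻¹' B) := by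
        refine measure_mono fun x hx => ?_
        simp only [mem_ofPred_eq] at hx
        by_cases h : d₁ x.1 < t - s₀
        · exact Or.inl ⟨hx, h⟩
        · refine Or.inr ⟨?_, ?_⟩ <;> simp only [Prod.fst_swap, Prod.snd_swap] <;> linarith
    _ ≤ ENNReal.ofReal c * (μ₁.prod μ₂) S + ENNReal.ofReal c * (μ₁.prod μ₂) S :=
        (measure_union_le _ _).trans (add_le_add hA hB)
    _ = ENNReal.ofReal (c + c) * (μ₁.prod μ₂) S := by
        rw [ENNReal.ofReal_add hc.le hc.le, add_mul]
    _ ≤ ENNReal.ofReal (1 + 3 * c) * (μ₁.prod μ₂) S :=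
        mul_le_mul_left (ENNReal.ofReal_le_ofReal (by linarith)) _
end

section
/- Let G₁, G₂ be locally compact second countable groups with Haar measures, with G₁ noncompact, and let d_i : G_i → [t₀,∞) be proper continuous functions. Set v₁(t) = vol({g ∈ G₁ : d₁(g) < t}) and v(t) = vol({(g₁,g₂) ∈ G₁×G₂ : d₁(g₁) + d₂(g₂) < t}) (product Haar measure). Suppose there exists c > 0 such that for all sufficiently small ε > 0 and all t ≥ t₀, v₁(t+ε) − v₁(t) ≤ cε·max{v₁(t), 1}. Then there exists s₀ ≥ 0 such that for all sufficiently small ε > 0 and all t ≥ 2t₀, v(t+ε) − v(t) ≤ cε·v(t+s₀). -/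
open MeasureTheory Filter Set
open scoped ENNReal NNReal

/-- The sublevel sets of a real function on a space of infinite measure have measure at least `1`
from some point on. -/
lemma exists_one_le_measure_lt {X : Type*} [MeasurableSpace X] (μ : Measure X)
    (hμ : μ univ = ∞) (d : X → ℝ) : ∃ a : ℝ, 1 ≤ μ {x | d x < a} := by
  have hmono : Monotone fun n : ℕ => {x | d x < (n : ℝ)} := fun m n hmn x hx =>
    lt_of_lt_of_le (α := ℝ) hx (by exact_mod_cast hmn)
  have hunion : ⋃ n : ℕ, {x | d x < (n : ℝ)} = univ :=
    eq_univ_of_forall fun x => mem_iUnion.2 (exists_nat_gt (d x))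
  have hlim := tendsto_measure_iUnion_atTop (μ := μ) hmono
  rw [hunion, hμ] at hlim
  obtain ⟨n, hn⟩ := (hlim.eventually (lt_mem_nhds ENNReal.one_lt_top)).exists
  exact ⟨n, hn.le⟩

/-- Fubini for the sublevel sets of `d₁ x + d₂ y`. -/
lemma prod_measure_add_lt {X Y : Type*} [MeasurableSpace X] [MeasurableSpace Y]
    (μ : Measure X) (ν : Measure Y) [SFinite μ] [SFinite ν] {d₁ : X → ℝ} {d₂ : Y → ℝ}
    (h₁ : Measurable d₁) (h₂ : Measurable d₂) (t : ℝ) :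
    (μ.prod ν) {x : X × Y | d₁ x.1 + d₂ x.2 < t} = ∫⁻ y, μ {x | d₁ x < t - d₂ y} ∂ν := by
  have hs : MeasurableSet {x : X × Y | d₁ x.1 + d₂ x.2 < t} :=
    measurableSet_lt ((h₁.comp measurable_fst).add (h₂.comp measurable_snd)) measurable_const
  rw [Measure.prod_apply_symm hs]
  simp only [preimage_ofPred_eq, lt_sub_iff_add_lt]

/-- An increment bound above the infimum `t₀` of `d` extends to all levels, once `max · 1` is
replaced by the volume at a shifted level. -/
lemma measure_lt_increment_le {X : Type*} [MeasurableSpace X] (μ : Measure X)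
    {d : X → ℝ} {t₀ c a ε₀ s₀ : ℝ} (hd : ∀ x, t₀ ≤ d x) (hc : 0 < c)
    (ha : 1 ≤ μ {x | d x < a}) (hs₀ : 0 ≤ s₀) (has : a - t₀ + ε₀ ≤ s₀)
    (hreg : ∀ ε : ℝ, 0 < ε → ε < ε₀ → ∀ t ≥ t₀,
      μ {x | d x < t + ε} - μ {x | d x < t}
        ≤ ENNReal.ofReal (c * ε) * max (μ {x | d x < t}) 1)
    {ε : ℝ} (hε : 0 < ε) (hεε₀ : ε < ε₀) (t : ℝ) :
    μ {x | d x < t + ε} - μ {x | d x < t}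
      ≤ ENNReal.ofReal (c * ε) * μ {x | d x < t + s₀} := by
  have hmono : ∀ {r s : ℝ}, r ≤ s → μ {x | d x < r} ≤ μ {x | d x < s} := fun h =>
    measure_mono fun x hx => lt_of_lt_of_le (α := ℝ) hx h
  have hzero : ∀ {r : ℝ}, r ≤ t₀ → μ {x | d x < r} = 0 := fun {r} h => by
    have : {x | d x < r} = ∅ := eq_empty_of_forall_notMem fun x hx =>
      absurd (hd x) (not_le.2 (lt_of_lt_of_le (α := ℝ) hx h))
    rw [this, measure_empty]
  rcases le_or_gt t₀ t with ht | ht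
  · refine (hreg ε hε hεε₀ t ht).trans ?_
    gcongr
    exact max_le (hmono (by linarith)) (ha.trans (hmono (by linarith)))
  rcases le_or_gt (t + ε) t₀ with hte | hte
  · simp [hzero hte]
  · have h := hreg (t + ε - t₀) (by linarith) (by linarith) t₀ le_rfl
    rw [hzero le_rfl, add_sub_cancel, tsub_zero, max_eq_right zero_le_one] at h
    refine tsub_le_self.trans (h.trans (mul_le_mul' (ENNReal.ofReal_le_ofReal ?_) ?_))
    · gcongr
      linarith
    · exact ha.trans (hmono (by linarith))

/-- **Increment volume regularity passes to products** (Gorodnik–Nevo, Proposition 8.6).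
Let `G₁, G₂` be lcsc groups with Haar measures `μ₁, μ₂`, `G₁` noncompact, and
`d_i : G_i → [t₀,∞)` proper continuous functions, with `v₁(t) = vol {d₁ < t}` and
`v(t) = vol {(g₁,g₂) : d₁(g₁) + d₂(g₂) < t}`. If there is `c > 0` such that
`v₁(t+ε) − v₁(t) ≤ cε · max{v₁(t), 1}` for all small `ε > 0` and all `t ≥ t₀`, then there
is `s₀ ≥ 0` such that `v(t+ε) − v(t) ≤ cε · v(t+s₀)` for all small `ε > 0` and all
`t ≥ 2t₀`. -/
theorem product_volume_increment
    {G₁ G₂ : Type*}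
    [Group G₁] [TopologicalSpace G₁] [IsTopologicalGroup G₁]
    [LocallyCompactSpace G₁] [SecondCountableTopology G₁] [NoncompactSpace G₁]
    [MeasurableSpace G₁] [BorelSpace G₁]
    [Group G₂] [TopologicalSpace G₂] [IsTopologicalGroup G₂]
    [LocallyCompactSpace G₂] [SecondCountableTopology G₂]
    [MeasurableSpace G₂] [BorelSpace G₂]
    (μ₁ : Measure G₁) [μ₁.IsHaarMeasure] (μ₂ : Measure G₂) [μ₂.IsHaarMeasure]
    (t₀ : ℝ) (d₁ : G₁ → ℝ) (d₂ : G₂ → ℝ)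
    (hd₁_cont : Continuous d₁) (hd₂_cont : Continuous d₂)
    (hd₁_lb : ∀ g, t₀ ≤ d₁ g) (hd₂_lb : ∀ g, t₀ ≤ d₂ g)
    (hd₁_proper : ∀ t : ℝ, IsCompact {g : G₁ | d₁ g ≤ t})
    (hd₂_proper : ∀ t : ℝ, IsCompact {g : G₂ | d₂ g ≤ t})
    (c : ℝ) (hc : 0 < c)
    (hreg : ∃ ε₀ > (0:ℝ), ∀ ε : ℝ, 0 < ε → ε < ε₀ → ∀ t ≥ t₀,
      μ₁ {g | d₁ g < t + ε} - μ₁ {g | d₁ g < t}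
        ≤ ENNReal.ofReal (c * ε) * max (μ₁ {g | d₁ g < t}) 1) :
    ∃ s₀ ≥ (0:ℝ), ∃ ε₁ > (0:ℝ), ∀ ε : ℝ, 0 < ε → ε < ε₁ → ∀ t ≥ 2 * t₀,
      (μ₁.prod μ₂) {x : G₁ × G₂ | d₁ x.1 + d₂ x.2 < t + ε}
          - (μ₁.prod μ₂) {x : G₁ × G₂ | d₁ x.1 + d₂ x.2 < t}
        ≤ ENNReal.ofReal (c * ε)
            * (μ₁.prod μ₂) {x : G₁ × G₂ | d₁ x.1 + d₂ x.2 < t + s₀} := by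
  obtain ⟨ε₀, hε₀, hreg⟩ := hreg
  obtain ⟨a, ha⟩ := exists_one_le_measure_lt μ₁ (measure_univ_of_isMulLeftInvariant μ₁) d₁
  refine ⟨max 0 (a - t₀ + ε₀), le_max_left _ _, ε₀, hε₀, fun ε hε hεε₀ t _ => ?_⟩
  have h₁ := hd₁_cont.measurable
  have h₂ := hd₂_cont.measurable
  have hmeas : ∀ s : ℝ, Measurable fun y => μ₁ {x | d₁ x < s - d₂ y} := fun s =>
    have hmono : Monotone fun r : ℝ => μ₁ {x | d₁ x < r} := fun _ _ h =>
      measure_mono fun _ hx => lt_of_lt_of_le (α := ℝ) hx h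
    hmono.measurable.comp (measurable_const.sub h₂)
  simp only [prod_measure_add_lt μ₁ μ₂ h₁ h₂]
  rw [← lintegral_const_mul _ (hmeas _)]
  refine (lintegral_sub_le _ _ (hmeas t)).trans (lintegral_mono fun y => ?_)
  have h := measure_lt_increment_le μ₁ hd₁_lb hc ha (le_max_left _ _) (le_max_right _ _) hreg
    hε hεε₀ (t - d₂ y)
  rwa [sub_add_eq_add_sub, sub_add_eq_add_sub] at h
end

section
/- Well-balancedness from volume growth: let G₁, G₂ be locally compact second countable noncompact groups with Haar measures, let d_i : G_i → [t₀,∞) be proper continuous functions, and v_i(t) = vol({g ∈ G_i : d_i(g) < t}). Suppose there exist s₀ > t₀, a_i, b_i > 0, u_i ≥ 0 and w_i > 0 such that a_i·t^{u_i}·e^{w_i t} ≤ v_i(t) ≤ b_i·t^{u_i}·e^{w_i t} for all t > s₀ and i = 1, 2. Fix p > 1 and set G_t = {(g₁,g₂) ∈ G₁×G₂ : d₁(g₁)^p + d₂(g₂)^p < t^p}. Then there exist α, β, C > 0 such that for all sufficiently large t: vol({(g₁,g₂) ∈ G_t : d₁(g₁) < αt}) ≤ C·e^{−βt}·vol(G_t)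 and vol({(g₁,g₂) ∈ G_t : d₂(g₂) < αt}) ≤ C·e^{−βt}·vol(G_t); that is, the families G_t are well-balanced. -/
open MeasureTheory Filter Set
open scoped ENNReal NNReal

/-- For `p > 1` the function `w₂ * x ^ p` is below `w₁ * x` at some `x ∈ (0, 1)`. -/
lemma exists_mul_rpow_lt {p w₁ w₂ : ℝ} (hp : 1 < p) (hw₁ : 0 < w₁) (hw₂ : 0 < w₂) :
    ∃ γ : ℝ, 0 < γ ∧ γ < 1 ∧ w₂ * γ ^ p < w₁ * γ := by
  have hq : 0 < p - 1 := sub_pos.2 hp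
  have hlim : Tendsto (fun x : ℝ => x ^ (p - 1)) (nhdsWithin 0 (Ioi 0)) (nhds 0) := by
    have h := (Real.continuousAt_rpow_const 0 (p - 1) (Or.inr hq.le)).tendsto
    rw [Real.zero_rpow hq.ne'] at h
    exact h.mono_left nhdsWithin_le_nhds
  obtain ⟨γ, hsmall, hγ0, hγ1⟩ :=
    ((hlim.eventually (gt_mem_nhds (div_pos hw₁ hw₂))).and
      (Ioo_mem_nhdsGT (zero_lt_one (α := ℝ)))).exists
  refine ⟨γ, hγ0, hγ1, ?_⟩
  have hpow : γ ^ p = γ ^ (p - 1) * γ := by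
    rw [← Real.rpow_add_one hγ0.ne', sub_add_cancel]
  rw [lt_div_iff₀ hw₂] at hsmall
  rw [hpow]
  nlinarith

/-- The part of an `ℓ^p`-ball, `p > 1`, on which the first coordinate is small relative to the
radius has exponentially small proportion, if both coordinates have exponential volume growth. -/
lemma exists_measure_small_fst_le {X Y : Type*} [MeasurableSpace X] [MeasurableSpace Y]
    (μ : Measure X) (ν : Measure Y) [SFinite ν]
    {d₁ : X → ℝ} {d₂ : Y → ℝ} (hd₁ : ∀ x, 0 ≤ d₁ x) (hd₂ : ∀ y, 0 ≤ d₂ y)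
    {s₀ a₁ a₂ b₁ b₂ u₁ u₂ w₁ w₂ p : ℝ} (ha₁ : 0 < a₁) (ha₂ : 0 < a₂) (hb₁ : 0 < b₁) (hb₂ : 0 < b₂)
    (hw₁ : 0 < w₁) (hw₂ : 0 < w₂)
    (hv₁ : ∀ t > s₀, ENNReal.ofReal (a₁ * t ^ u₁ * Real.exp (w₁ * t)) ≤ μ {g | d₁ g < t} ∧
      μ {g | d₁ g < t} ≤ ENNReal.ofReal (b₁ * t ^ u₁ * Real.exp (w₁ * t)))
    (hv₂ : ∀ t > s₀, ENNReal.ofReal (a₂ * t ^ u₂ * Real.exp (w₂ * t)) ≤ ν {g | d₂ g < t} ∧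
      ν {g | d₂ g < t} ≤ ENNReal.ofReal (b₂ * t ^ u₂ * Real.exp (w₂ * t)))
    (hp : 1 < p) :
    ∃ α > (0:ℝ), ∃ β > (0:ℝ), ∃ C > (0:ℝ), ∀ᶠ t in atTop,
      (μ.prod ν) {x : X × Y | d₁ x.1 ^ p + d₂ x.2 ^ p < t ^ p ∧ d₁ x.1 < α * t}
          ≤ ENNReal.ofReal (C * Real.exp (-β * t))
            * (μ.prod ν) {x : X × Y | d₁ x.1 ^ p + d₂ x.2 ^ p < t ^ p} := by
  have hp0 : 0 < p := one_pos.trans hp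
  obtain ⟨γ, hγ0, hγ1, hγ⟩ := exists_mul_rpow_lt hp hw₁ hw₂
  have hγp : γ ^ p < 1 := Real.rpow_lt_one hγ0.le hγ1 hp0
  obtain ⟨δ, hδ⟩ : ∃ δ, δ = 1 - γ ^ p := ⟨_, rfl⟩
  have hδ0 : 0 < δ := by linarith
  have hδ1 : δ ≤ 1 := by linarith [Real.rpow_nonneg hγ0.le p]
  have hsum : γ ^ p + δ ^ p ≤ 1 := by
    linarith [Real.rpow_le_self_of_le_one hδ0.le hδ1 hp.le]
  obtain ⟨α, hα⟩ : ∃ α, α = (w₁ * γ - w₂ * γ ^ p) / (2 * w₁) := ⟨_, rfl⟩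
  have hα0 : 0 < α := hα ▸ div_pos (sub_pos.2 hγ) (by positivity)
  have hαw : 2 * (α * w₁) = w₁ * γ - w₂ * γ ^ p := by rw [hα]; field_simp
  refine ⟨α, hα0, w₁ * α, by positivity,
    b₁ * b₂ * α ^ u₁ / (a₁ * a₂ * γ ^ u₁ * δ ^ u₂), by positivity, ?_⟩
  have hlarge : ∀ c : ℝ, 0 < c → ∀ᶠ t : ℝ in atTop, s₀ < c * t := fun c hc =>
    (tendsto_id.const_mul_atTop hc).eventually_gt_atTop s₀
  filter_upwards [hlarge α hα0, hlarge γ hγ0, hlarge δ hδ0, eventually_gt_atTop s₀,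
    eventually_gt_atTop 0] with t htα htγ htδ ht ht0
  have hupper : {x : X × Y | d₁ x.1 ^ p + d₂ x.2 ^ p < t ^ p ∧ d₁ x.1 < α * t} ⊆
      {g | d₁ g < α * t} ×ˢ {g | d₂ g < t} := fun x hx => ⟨hx.2,
    (Real.rpow_lt_rpow_iff (hd₂ x.2) ht0.le hp0).1
      (by linarith [hx.1, Real.rpow_nonneg (hd₁ x.1) p])⟩
  have hlower : {g | d₁ g < γ * t} ×ˢ {g | d₂ g < δ * t} ⊆
      {x : X × Y | d₁ x.1 ^ p + d₂ x.2 ^ p < t ^ p} := by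
    rintro x ⟨h₁, h₂⟩
    calc d₁ x.1 ^ p + d₂ x.2 ^ p
        < (γ * t) ^ p + (δ * t) ^ p :=
          add_lt_add (Real.rpow_lt_rpow (hd₁ _) h₁ hp0) (Real.rpow_lt_rpow (hd₂ _) h₂ hp0)
      _ = (γ ^ p + δ ^ p) * t ^ p := by
          rw [Real.mul_rpow hγ0.le ht0.le, Real.mul_rpow hδ0.le ht0.le, add_mul]
      _ ≤ t ^ p := mul_le_of_le_one_left (Real.rpow_nonneg ht0.le p) hsum
  have hexp : Real.exp (w₁ * (α * t)) * Real.exp (w₂ * t) = Real.exp (-(w₁ * α) * t) *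
      (Real.exp (w₁ * (γ * t)) * Real.exp (w₂ * (δ * t))) := by
    simp only [← Real.exp_add]
    congr 1
    rw [hδ]
    linear_combination t * hαw
  have hcomp : b₁ * (α * t) ^ u₁ * Real.exp (w₁ * (α * t)) *
        (b₂ * t ^ u₂ * Real.exp (w₂ * t)) =
      b₁ * b₂ * α ^ u₁ / (a₁ * a₂ * γ ^ u₁ * δ ^ u₂) * Real.exp (-(w₁ * α) * t) *
        (a₁ * (γ * t) ^ u₁ * Real.exp (w₁ * (γ * t)) *
          (a₂ * (δ * t) ^ u₂ * Real.exp (w₂ * (δ * t)))) := by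
    rw [Real.mul_rpow hα0.le ht0.le, Real.mul_rpow hγ0.le ht0.le, Real.mul_rpow hδ0.le ht0.le]
    have hγu : γ ^ u₁ ≠ 0 := by positivity
    have hδu : δ ^ u₂ ≠ 0 := by positivity
    generalize γ ^ u₁ = A at *
    generalize δ ^ u₂ = B at *
    rw [div_mul_eq_mul_div, div_mul_eq_mul_div, eq_div_iff (by positivity)]
    linear_combination b₁ * b₂ * α ^ u₁ * t ^ u₁ * t ^ u₂ * (a₁ * a₂ * A * B) * hexp
  calc (μ.prod ν) {x : X × Y | d₁ x.1 ^ p + d₂ x.2 ^ p < t ^ p ∧ d₁ x.1 < α * t}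
      ≤ μ {g | d₁ g < α * t} * ν {g | d₂ g < t} :=
        (measure_mono hupper).trans_eq (Measure.prod_prod _ _)
    _ ≤ ENNReal.ofReal (b₁ * (α * t) ^ u₁ * Real.exp (w₁ * (α * t))) *
          ENNReal.ofReal (b₂ * t ^ u₂ * Real.exp (w₂ * t)) :=
        mul_le_mul' (hv₁ _ htα).2 (hv₂ _ ht).2
    _ = ENNReal.ofReal (b₁ * b₂ * α ^ u₁ / (a₁ * a₂ * γ ^ u₁ * δ ^ u₂) *
            Real.exp (-(w₁ * α) * t)) *
          (ENNReal.ofReal (a₁ * (γ * t) ^ u₁ * Real.exp (w₁ * (γ * t))) *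
            ENNReal.ofReal (a₂ * (δ * t) ^ u₂ * Real.exp (w₂ * (δ * t)))) := by
        rw [← ENNReal.ofReal_mul (by positivity), ← ENNReal.ofReal_mul (by positivity),
          ← ENNReal.ofReal_mul (by positivity), hcomp]
    _ ≤ ENNReal.ofReal (b₁ * b₂ * α ^ u₁ / (a₁ * a₂ * γ ^ u₁ * δ ^ u₂) *
            Real.exp (-(w₁ * α) * t)) *
          (μ {g | d₁ g < γ * t} * ν {g | d₂ g < δ * t}) :=
        mul_le_mul_right (mul_le_mul' (hv₁ _ htγ).1 (hv₂ _ htδ).1) _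
    _ ≤ _ := mul_le_mul_right ((Measure.prod_prod _ _).symm.trans_le (measure_mono hlower)) _

/-- **Well-balancedness from volume growth** (Gorodnik–Nevo, Proposition 8.7).
Let `G₁, G₂` be lcsc noncompact groups with Haar measures `μ₁, μ₂` and
`d_i : G_i → [t₀,∞)` proper continuous functions whose ball volumes satisfy
`a_i t^{u_i} e^{w_i t} ≤ v_i(t) ≤ b_i t^{u_i} e^{w_i t}` for `t > s₀`. For `p > 1`, the
family `G_t = {(g₁,g₂) : d₁(g₁)^p + d₂(g₂)^p < t^p}` is well-balanced: there are
`α, β, C > 0` so that for large `t` the part of `G_t` where either `d_i(g_i) < αt` has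
volume at most `C e^{−βt} vol(G_t)`. -/
theorem wellBalanced_of_volume_growth
    {G₁ G₂ : Type*}
    [Group G₁] [TopologicalSpace G₁] [IsTopologicalGroup G₁]
    [LocallyCompactSpace G₁] [SecondCountableTopology G₁] [NoncompactSpace G₁]
    [MeasurableSpace G₁] [BorelSpace G₁]
    [Group G₂] [TopologicalSpace G₂] [IsTopologicalGroup G₂]
    [LocallyCompactSpace G₂] [SecondCountableTopology G₂] [NoncompactSpace G₂]
    [MeasurableSpace G₂] [BorelSpace G₂]
    (μ₁ : Measure G₁) [μ₁.IsHaarMeasure] (μ₂ : Measure G₂) [μ₂.IsHaarMeasure]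
    (t₀ : ℝ) (ht₀ : 0 ≤ t₀) (d₁ : G₁ → ℝ) (d₂ : G₂ → ℝ)
    (hd₁_cont : Continuous d₁) (hd₂_cont : Continuous d₂)
    (hd₁_lb : ∀ g, t₀ ≤ d₁ g) (hd₂_lb : ∀ g, t₀ ≤ d₂ g)
    (hd₁_proper : ∀ t : ℝ, IsCompact {g : G₁ | d₁ g ≤ t})
    (hd₂_proper : ∀ t : ℝ, IsCompact {g : G₂ | d₂ g ≤ t})
    (s₀ : ℝ) (hs₀ : t₀ < s₀)
    (a₁ a₂ b₁ b₂ : ℝ) (ha₁ : 0 < a₁) (ha₂ : 0 < a₂) (hb₁ : 0 < b₁) (hb₂ : 0 < b₂)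
    (u₁ u₂ : ℝ) (hu₁ : 0 ≤ u₁) (hu₂ : 0 ≤ u₂)
    (w₁ w₂ : ℝ) (hw₁ : 0 < w₁) (hw₂ : 0 < w₂)
    (hv₁ : ∀ t > s₀, ENNReal.ofReal (a₁ * t ^ u₁ * Real.exp (w₁ * t)) ≤ μ₁ {g | d₁ g < t} ∧
      μ₁ {g | d₁ g < t} ≤ ENNReal.ofReal (b₁ * t ^ u₁ * Real.exp (w₁ * t)))
    (hv₂ : ∀ t > s₀, ENNReal.ofReal (a₂ * t ^ u₂ * Real.exp (w₂ * t)) ≤ μ₂ {g | d₂ g < t} ∧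
      μ₂ {g | d₂ g < t} ≤ ENNReal.ofReal (b₂ * t ^ u₂ * Real.exp (w₂ * t)))
    (p : ℝ) (hp : 1 < p) :
    ∃ α > (0:ℝ), ∃ β > (0:ℝ), ∃ C > (0:ℝ), ∀ᶠ t in atTop,
      (μ₁.prod μ₂) {x : G₁ × G₂ | d₁ x.1 ^ p + d₂ x.2 ^ p < t ^ p ∧ d₁ x.1 < α * t}
          ≤ ENNReal.ofReal (C * Real.exp (-β * t))
            * (μ₁.prod μ₂) {x : G₁ × G₂ | d₁ x.1 ^ p + d₂ x.2 ^ p < t ^ p} ∧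
      (μ₁.prod μ₂) {x : G₁ × G₂ | d₁ x.1 ^ p + d₂ x.2 ^ p < t ^ p ∧ d₂ x.2 < α * t}
          ≤ ENNReal.ofReal (C * Real.exp (-β * t))
            * (μ₁.prod μ₂) {x : G₁ × G₂ | d₁ x.1 ^ p + d₂ x.2 ^ p < t ^ p} := by
  obtain ⟨α, hα, β, hβ, C, hC, h⟩ := exists_measure_small_fst_le μ₁ μ₂
    (fun g => ht₀.trans (hd₁_lb g)) (fun g => ht₀.trans (hd₂_lb g))
    ha₁ ha₂ hb₁ hb₂ hw₁ hw₂ hv₁ hv₂ hp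
  obtain ⟨α', hα', β', hβ', C', hC', h'⟩ := exists_measure_small_fst_le μ₂ μ₁
    (fun g => ht₀.trans (hd₂_lb g)) (fun g => ht₀.trans (hd₁_lb g))
    ha₂ ha₁ hb₂ hb₁ hw₂ hw₁ hv₂ hv₁ hp
  have hswap : ∀ S : Set (G₂ × G₁), (μ₂.prod μ₁) S = (μ₁.prod μ₂) (Prod.swap ⁻¹' S) := fun S =>
    (MeasurePreserving.measure_preimage_equiv (f := MeasurableEquiv.prodComm)
      (Measure.measurePreserving_swap (μ := μ₁) (ν := μ₂)) S).symm
  refine ⟨min α α', lt_min hα hα', min β β', lt_min hβ hβ', max C C', lt_max_of_lt_left hC, ?_⟩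
  filter_upwards [h, h', eventually_ge_atTop 0] with t ht ht' ht0
  constructor
  · refine le_trans (measure_mono ?_)
      (ht.trans (mul_le_mul_left (ENNReal.ofReal_le_ofReal ?_) _))
    · exact fun x hx => ⟨hx.1, hx.2.trans_le (mul_le_mul_of_nonneg_right (min_le_left _ _) ht0)⟩
    · gcongr
      exacts [le_max_left _ _, min_le_left _ _]
  · simp only [hswap, preimage_ofPred_eq, Prod.fst_swap, Prod.snd_swap,
      add_comm (d₂ _ ^ p)] at ht'
    refine le_trans (measure_mono ?_)
      (ht'.trans (mul_le_mul_left (ENNReal.ofReal_le_ofReal ?_) _))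
    · exact fun x hx => ⟨hx.1, hx.2.trans_le (mul_le_mul_of_nonneg_right (min_le_right _ _) ht0)⟩
    · gcongr
      exacts [le_max_right _ _, min_le_right _ _]
end

section
/- Balancedness after rescaling: let G₁, G₂ be locally compact second countable noncompact groups with Haar measures, let d_i : G_i → [t₀,∞) be proper continuous functions, and v_i(t) = vol({g ∈ G_i : d_i(g) < t}). Suppose there exist s₀ > t₀, a_i, b_i > 0, u_i ≥ 0 and w_i > 0 such that a_i·t^{u_i}·e^{w_i t} ≤ v_i(t) ≤ b_i·t^{u_i}·e^{w_i t} for all t > s₀ and i = 1, 2. Then there exist α₁, α₂ > 0 such that the sets G_t = {(g₁,g₂) ∈ G₁×G₂ : α₁·d₁(g₁) + α₂·d₂(g₂) < t} are balanced: for every r > 0, vol({(g₁,g₂) ∈ G_t : d₁(g₁) ≤ r}) / vol(G_t) → 0 and vol({(g₁,g₂) ∈ G_t : d₂(g₂) ≤ r}) / vol(G_t) → 0 as t → ∞. -/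
open MeasureTheory Filter Set
open scoped ENNReal NNReal

/-- A function whose sublevel sets grow at least like `exp (w * t)` has
`exp (-w * f)` of infinite integral. -/
lemma lintegral_exp_neg_eq_top {X : Type*} [MeasurableSpace X] {μ : Measure X} {f : X → ℝ}
    (hf : Measurable f) {a w : ℝ} (ha : 0 < a) (hw : 0 < w)
    (hμ : ∀ᶠ t in atTop, ENNReal.ofReal (a * Real.exp (w * t)) ≤ μ {x | f x < t}) :
    ∫⁻ x, ENNReal.ofReal (Real.exp (-(w * f x))) ∂μ = ∞ := by
  by_contra hfin
  have hms (t : ℝ) : MeasurableSet {x | f x < t} := measurableSet_lt hf measurable_const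
  have hlim : Tendsto (fun t : ℝ => ∫⁻ x, {x | f x < t}.indicator
      (fun _ => ENNReal.ofReal (Real.exp (-(w * t)))) x ∂μ) atTop (nhds (∫⁻ _, 0 ∂μ)) := by
    refine tendsto_lintegral_filter_of_dominated_convergence _
      (.of_forall fun t => measurable_const.indicator (hms t)) ?_ hfin ?_
    · refine .of_forall fun t => .of_forall fun x => ?_
      refine indicator_apply_le' (fun hx : f x < t => ?_) fun _ => zero_le
      gcongr
    · refine .of_forall fun x => ?_
      have h0 : Tendsto (fun t : ℝ => ENNReal.ofReal (Real.exp (-(w * t)))) atTop (nhds 0) := by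
        rw [← ENNReal.ofReal_zero]
        exact ENNReal.tendsto_ofReal (Real.tendsto_exp_neg_atTop_nhds_zero.comp
          (tendsto_id.const_mul_atTop hw))
      exact tendsto_of_tendsto_of_tendsto_of_le_of_le tendsto_const_nhds h0
        (fun _ => zero_le)
        (fun t => indicator_apply_le' (fun _ => le_rfl) fun _ => zero_le)
  rw [lintegral_zero] at hlim
  refine (ENNReal.ofReal_pos.2 ha).not_ge (ge_of_tendsto hlim ?_)
  filter_upwards [hμ] with t ht
  rw [lintegral_indicator_const (hms t)]
  calc ENNReal.ofReal a
      = ENNReal.ofReal (Real.exp (-(w * t))) * ENNReal.ofReal (a * Real.exp (w * t)) := by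
        rw [← ENNReal.ofReal_mul (Real.exp_pos _).le, mul_left_comm, ← Real.exp_add]
        simp
    _ ≤ _ := by gcongr

/-- Under exponential volume growth in both factors, the product sublevel sets of
`w₁ * f + w₂ * g` grow strictly faster than `t ^ u * exp t`. -/
lemma tendsto_prod_sublevel_div_atTop {X Y : Type*} [MeasurableSpace X] [MeasurableSpace Y]
    {μ : Measure X} {ν : Measure Y} [SFinite ν] {f : X → ℝ} {g : Y → ℝ}
    (hf : Measurable f) (hg : Measurable g) {a₁ a₂ u w₁ w₂ : ℝ}
    (ha₁ : 0 < a₁) (ha₂ : 0 < a₂) (hu : 0 ≤ u) (hw₁ : 0 < w₁) (hw₂ : 0 < w₂)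
    (hμ : ∀ᶠ t in atTop, ENNReal.ofReal (a₁ * Real.exp (w₁ * t)) ≤ μ {x | f x < t})
    (hν : ∀ᶠ t in atTop,
      ENNReal.ofReal (a₂ * t ^ u * Real.exp (w₂ * t)) ≤ ν {y | g y < t}) :
    Tendsto (fun t : ℝ => (μ.prod ν) {x : X × Y | w₁ * f x.1 + w₂ * g x.2 < t}
      / ENNReal.ofReal (t ^ u * Real.exp t)) atTop (nhds ∞) := by
  have hms (t : ℝ) : MeasurableSet {x : X × Y | w₁ * f x.1 + w₂ * g x.2 < t} :=
    measurableSet_lt (by fun_prop) measurable_const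
  set c : ℝ := a₂ * (1 / (2 * w₂)) ^ u with hc_def
  have hc : 0 < c := by positivity
  have hlb (x : X) : ∀ᶠ t : ℝ in atTop,
      ENNReal.ofReal c * ENNReal.ofReal (Real.exp (-(w₁ * f x))) ≤
        ν (Prod.mk x ⁻¹' {x : X × Y | w₁ * f x.1 + w₂ * g x.2 < t})
          / ENNReal.ofReal (t ^ u * Real.exp t) := by
    have hlim : Tendsto (fun t : ℝ => (t - w₁ * f x) / w₂) atTop atTop :=
      (tendsto_atTop_add_const_right _ (-(w₁ * f x)) tendsto_id).atTop_div_const hw₂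
    filter_upwards [hlim.eventually hν, eventually_gt_atTop 0,
      eventually_ge_atTop (2 * (w₁ * f x))] with t ht ht0 ht2
    have hset : Prod.mk x ⁻¹' {x : X × Y | w₁ * f x.1 + w₂ * g x.2 < t} =
        {y | g y < (t - w₁ * f x) / w₂} := by
      ext y
      simp only [mem_preimage, mem_ofPred_eq, lt_div_iff₀ hw₂]
      constructor <;> intro h <;> linarith
    rw [hset, ENNReal.le_div_iff_mul_le (.inl (by simp; positivity)) (.inl (by simp)),
      ← ENNReal.ofReal_mul hc.le, ← ENNReal.ofReal_mul (by positivity)]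
    refine (ENNReal.ofReal_le_ofReal ?_).trans ht
    have hpow : (1 / (2 * w₂)) ^ u * t ^ u ≤ ((t - w₁ * f x) / w₂) ^ u := by
      rw [← Real.mul_rpow (by positivity) ht0.le]
      refine Real.rpow_le_rpow (by positivity) ?_ hu
      rw [le_div_iff₀ hw₂]
      field_simp
      linarith
    have hexp : Real.exp (w₂ * ((t - w₁ * f x) / w₂)) =
        Real.exp (-(w₁ * f x)) * Real.exp t := by
      rw [← Real.exp_add]
      congr 1
      field_simp
      ring
    rw [hexp]
    calc c * Real.exp (-(w₁ * f x)) * (t ^ u * Real.exp t)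
        = a₂ * ((1 / (2 * w₂)) ^ u * t ^ u) * (Real.exp (-(w₁ * f x)) * Real.exp t) := by
          rw [hc_def]; ring
      _ ≤ _ := by gcongr
  have htop : (∞ : ℝ≥0∞) ≤ liminf (fun t : ℝ =>
      (μ.prod ν) {x : X × Y | w₁ * f x.1 + w₂ * g x.2 < t}
        / ENNReal.ofReal (t ^ u * Real.exp t)) atTop := by
    calc (∞ : ℝ≥0∞)
        = ∫⁻ x, ENNReal.ofReal c * ENNReal.ofReal (Real.exp (-(w₁ * f x))) ∂μ := by
          rw [lintegral_const_mul _ (by fun_prop), lintegral_exp_neg_eq_top hf ha₁ hw₁ hμ,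
            ENNReal.mul_top (by simpa using hc)]
      _ ≤ ∫⁻ x, liminf (fun t : ℝ =>
            ν (Prod.mk x ⁻¹' {x : X × Y | w₁ * f x.1 + w₂ * g x.2 < t})
              / ENNReal.ofReal (t ^ u * Real.exp t)) atTop ∂μ :=
          lintegral_mono fun x => le_liminf_of_le (by isBoundedDefault) (hlb x)
      _ ≤ liminf (fun t : ℝ => ∫⁻ x,
            ν (Prod.mk x ⁻¹' {x : X × Y | w₁ * f x.1 + w₂ * g x.2 < t})
              / ENNReal.ofReal (t ^ u * Real.exp t) ∂μ) atTop :=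
          lintegral_liminf_le fun t => (measurable_measure_prodMk_left (hms t)).div_const _
      _ = _ := by
          congr 1
          ext t
          simp_rw [div_eq_mul_inv]
          rw [lintegral_mul_const _ (measurable_measure_prodMk_left (hms t)),
            Measure.prod_apply (hms t)]
  exact tendsto_of_le_liminf_of_limsup_le htop le_top

/-- The part of the product sublevel set where the first coordinate stays in a fixed sublevel
set of finite measure is asymptotically negligible. -/
lemma tendsto_relative_volume_zero {X Y : Type*} [MeasurableSpace X] [MeasurableSpace Y]
    {μ : Measure X} {ν : Measure Y} [SFinite ν] {f : X → ℝ} {g : Y → ℝ}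
    (hf : Measurable f) (hg : Measurable g) {t₀ r a₁ a₂ b₂ u w₁ w₂ : ℝ}
    (hlb : ∀ x, t₀ ≤ f x) (hr : μ {x | f x ≤ r} ≠ ∞)
    (ha₁ : 0 < a₁) (ha₂ : 0 < a₂) (hb₂ : 0 < b₂) (hu : 0 ≤ u) (hw₁ : 0 < w₁) (hw₂ : 0 < w₂)
    (hμ : ∀ᶠ t in atTop, ENNReal.ofReal (a₁ * Real.exp (w₁ * t)) ≤ μ {x | f x < t})
    (hν : ∀ᶠ t in atTop,
      ENNReal.ofReal (a₂ * t ^ u * Real.exp (w₂ * t)) ≤ ν {y | g y < t} ∧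
      ν {y | g y < t} ≤ ENNReal.ofReal (b₂ * t ^ u * Real.exp (w₂ * t))) :
    Tendsto (fun t : ℝ =>
        ((μ.prod ν) {x : X × Y | w₁ * f x.1 + w₂ * g x.2 < t ∧ f x.1 ≤ r}).toReal
          / ((μ.prod ν) {x : X × Y | w₁ * f x.1 + w₂ * g x.2 < t}).toReal)
      atTop (nhds 0) := by
  set C : ℝ := b₂ * (2 / w₂) ^ u * Real.exp (-(w₁ * t₀)) with hC_def
  have hD := tendsto_prod_sublevel_div_atTop hf hg ha₁ ha₂ hu hw₁ hw₂ hμ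
    (hν.mono fun _ h => h.1)
  have hlim : Tendsto (fun t : ℝ => (t - w₁ * t₀) / w₂) atTop atTop :=
    (tendsto_atTop_add_const_right _ (-(w₁ * t₀)) tendsto_id).atTop_div_const hw₂
  have hN : ∀ᶠ t : ℝ in atTop,
      (μ.prod ν) {x : X × Y | w₁ * f x.1 + w₂ * g x.2 < t ∧ f x.1 ≤ r} ≤
        μ {x | f x ≤ r} * ENNReal.ofReal C * ENNReal.ofReal (t ^ u * Real.exp t) := by
    filter_upwards [hlim.eventually hν, eventually_gt_atTop 0,
      eventually_ge_atTop (-(w₁ * t₀)), eventually_ge_atTop (w₁ * t₀)] with t ht ht0 ht1 ht2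
    have hsub : {x : X × Y | w₁ * f x.1 + w₂ * g x.2 < t ∧ f x.1 ≤ r} ⊆
        {x | f x ≤ r} ×ˢ {y | g y < (t - w₁ * t₀) / w₂} := by
      rintro ⟨x, y⟩ ⟨h, hx⟩
      refine ⟨hx, ?_⟩
      have := mul_le_mul_of_nonneg_left (hlb x) hw₁.le
      simp only [mem_ofPred_eq, lt_div_iff₀ hw₂] at h ⊢
      linarith
    refine (measure_mono hsub).trans ?_
    rw [Measure.prod_prod, mul_assoc, ← ENNReal.ofReal_mul (by positivity)]
    gcongr
    refine ht.2.trans (ENNReal.ofReal_le_ofReal ?_)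
    have hpow : ((t - w₁ * t₀) / w₂) ^ u ≤ (2 / w₂) ^ u * t ^ u := by
      rw [← Real.mul_rpow (by positivity) ht0.le]
      refine Real.rpow_le_rpow (div_nonneg (by linarith) hw₂.le) ?_ hu
      rw [div_mul_eq_mul_div]
      gcongr
      linarith
    have hexp : Real.exp (w₂ * ((t - w₁ * t₀) / w₂)) =
        Real.exp (-(w₁ * t₀)) * Real.exp t := by
      rw [← Real.exp_add]
      congr 1
      field_simp
      ring
    rw [hexp]
    calc b₂ * ((t - w₁ * t₀) / w₂) ^ u * (Real.exp (-(w₁ * t₀)) * Real.exp t)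
        ≤ b₂ * ((2 / w₂) ^ u * t ^ u) * (Real.exp (-(w₁ * t₀)) * Real.exp t) := by gcongr
      _ = C * (t ^ u * Real.exp t) := by rw [hC_def]; ring
  have hquot : Tendsto (fun t : ℝ =>
      (μ.prod ν) {x : X × Y | w₁ * f x.1 + w₂ * g x.2 < t ∧ f x.1 ≤ r}
        / (μ.prod ν) {x : X × Y | w₁ * f x.1 + w₂ * g x.2 < t}) atTop (nhds 0) := by
    have hM : μ {x | f x ≤ r} * ENNReal.ofReal C ≠ ∞ :=
      ENNReal.mul_ne_top hr ENNReal.ofReal_ne_top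
    have hdiv := ENNReal.Tendsto.const_div hD (.inr hM)
    rw [ENNReal.div_top] at hdiv
    refine tendsto_of_tendsto_of_tendsto_of_le_of_le' tendsto_const_nhds hdiv
      (.of_forall fun _ => zero_le) ?_
    filter_upwards [hN, eventually_gt_atTop 0] with t ht ht0
    have hH : ENNReal.ofReal (t ^ u * Real.exp t) ≠ 0 := by simp; positivity
    refine (ENNReal.div_le_div_right ht _).trans_eq ?_
    rw [div_eq_mul_inv, div_eq_mul_inv _ (_ / _),
      ENNReal.inv_div (.inl ENNReal.ofReal_ne_top) (.inl hH), mul_assoc, ← div_eq_mul_inv]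
  simpa only [Function.comp_def, ENNReal.toReal_div, ENNReal.toReal_zero] using
    (ENNReal.tendsto_toReal ENNReal.zero_ne_top).comp hquot

/-- Discarding the polynomial factor in a lower volume growth bound. -/
lemma eventually_exp_le_of_volume_growth {X : Type*} [MeasurableSpace X] {μ : Measure X}
    {d : X → ℝ} {a u w : ℝ} (ha : 0 < a) (hu : 0 ≤ u)
    (hv : ∀ᶠ t in atTop, ENNReal.ofReal (a * t ^ u * Real.exp (w * t)) ≤ μ {x | d x < t}) :
    ∀ᶠ t in atTop, ENNReal.ofReal (a * Real.exp (w * t)) ≤ μ {x | d x < t} := by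
  filter_upwards [hv, eventually_ge_atTop 1] with t ht ht1
  refine (ENNReal.ofReal_le_ofReal ?_).trans ht
  gcongr
  exact le_mul_of_one_le_right ha.le (Real.one_le_rpow ht1 hu)

/-- **Balancedness after rescaling** (Gorodnik–Nevo, Proposition 8.8).
Let `G₁, G₂` be lcsc noncompact groups with Haar measures `μ₁, μ₂` and
`d_i : G_i → [t₀,∞)` proper continuous functions whose ball volumes satisfy
`a_i t^{u_i} e^{w_i t} ≤ v_i(t) ≤ b_i t^{u_i} e^{w_i t}` for `t > s₀`. Then there are
`α₁, α₂ > 0` so that the family `G_t = {(g₁,g₂) : α₁ d₁(g₁) + α₂ d₂(g₂) < t}` is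
balanced: for every `r > 0`, the relative volume in `G_t` of the set where `d_i(g_i) ≤ r`
tends to `0` as `t → ∞`, for `i = 1, 2`. -/
theorem balanced_of_volume_growth
    {G₁ G₂ : Type*}
    [Group G₁] [TopologicalSpace G₁] [IsTopologicalGroup G₁]
    [LocallyCompactSpace G₁] [SecondCountableTopology G₁] [NoncompactSpace G₁]
    [MeasurableSpace G₁] [BorelSpace G₁]
    [Group G₂] [TopologicalSpace G₂] [IsTopologicalGroup G₂]
    [LocallyCompactSpace G₂] [SecondCountableTopology G₂] [NoncompactSpace G₂]
    [MeasurableSpace G₂] [BorelSpace G₂]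
    (μ₁ : Measure G₁) [μ₁.IsHaarMeasure] (μ₂ : Measure G₂) [μ₂.IsHaarMeasure]
    (t₀ : ℝ) (d₁ : G₁ → ℝ) (d₂ : G₂ → ℝ)
    (hd₁_cont : Continuous d₁) (hd₂_cont : Continuous d₂)
    (hd₁_lb : ∀ g, t₀ ≤ d₁ g) (hd₂_lb : ∀ g, t₀ ≤ d₂ g)
    (hd₁_proper : ∀ t : ℝ, IsCompact {g : G₁ | d₁ g ≤ t})
    (hd₂_proper : ∀ t : ℝ, IsCompact {g : G₂ | d₂ g ≤ t})
    (s₀ : ℝ) (hs₀ : t₀ < s₀)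
    (a₁ a₂ b₁ b₂ : ℝ) (ha₁ : 0 < a₁) (ha₂ : 0 < a₂) (hb₁ : 0 < b₁) (hb₂ : 0 < b₂)
    (u₁ u₂ : ℝ) (hu₁ : 0 ≤ u₁) (hu₂ : 0 ≤ u₂)
    (w₁ w₂ : ℝ) (hw₁ : 0 < w₁) (hw₂ : 0 < w₂)
    (hv₁ : ∀ t > s₀, ENNReal.ofReal (a₁ * t ^ u₁ * Real.exp (w₁ * t)) ≤ μ₁ {g | d₁ g < t} ∧
      μ₁ {g | d₁ g < t} ≤ ENNReal.ofReal (b₁ * t ^ u₁ * Real.exp (w₁ * t)))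
    (hv₂ : ∀ t > s₀, ENNReal.ofReal (a₂ * t ^ u₂ * Real.exp (w₂ * t)) ≤ μ₂ {g | d₂ g < t} ∧
      μ₂ {g | d₂ g < t} ≤ ENNReal.ofReal (b₂ * t ^ u₂ * Real.exp (w₂ * t))) :
    ∃ α₁ > (0:ℝ), ∃ α₂ > (0:ℝ), ∀ r > (0:ℝ),
      Tendsto (fun t : ℝ =>
          ((μ₁.prod μ₂) {x : G₁ × G₂ |
              α₁ * d₁ x.1 + α₂ * d₂ x.2 < t ∧ d₁ x.1 ≤ r}).toReal
            / ((μ₁.prod μ₂) {x : G₁ × G₂ | α₁ * d₁ x.1 + α₂ * d₂ x.2 < t}).toReal)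
        atTop (nhds 0) ∧
      Tendsto (fun t : ℝ =>
          ((μ₁.prod μ₂) {x : G₁ × G₂ |
              α₁ * d₁ x.1 + α₂ * d₂ x.2 < t ∧ d₂ x.2 ≤ r}).toReal
            / ((μ₁.prod μ₂) {x : G₁ × G₂ | α₁ * d₁ x.1 + α₂ * d₂ x.2 < t}).toReal)
        atTop (nhds 0) := by
  refine ⟨w₁, hw₁, w₂, hw₂, fun r _ => ⟨?_, ?_⟩⟩
  · exact tendsto_relative_volume_zero hd₁_cont.measurable hd₂_cont.measurable hd₁_lb
      (hd₁_proper r).measure_ne_top ha₁ ha₂ hb₂ hu₂ hw₁ hw₂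
      (eventually_exp_le_of_volume_growth ha₁ hu₁
        ((eventually_gt_atTop s₀).mono fun t ht => (hv₁ t ht).1))
      ((eventually_gt_atTop s₀).mono hv₂)
  · have h := tendsto_relative_volume_zero hd₂_cont.measurable hd₁_cont.measurable hd₂_lb
      (hd₂_proper r).measure_ne_top ha₂ ha₁ hb₁ hu₁ hw₂ hw₁
      (eventually_exp_le_of_volume_growth ha₂ hu₂
        ((eventually_gt_atTop s₀).mono fun t ht => (hv₂ t ht).1))
      ((eventually_gt_atTop s₀).mono hv₁)
    have hswap (s : Set (G₁ × G₂)) :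
        (μ₁.prod μ₂) s = (μ₂.prod μ₁) (Prod.swap ⁻¹' s) := by
      rw [← Measure.prod_swap]
      exact MeasurableEquiv.prodComm.map_apply s
    simpa only [hswap, preimage_ofPred_eq, Prod.fst_swap, Prod.snd_swap,
      add_comm (w₁ * _)] using h
end
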